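/- arXiv:2002.05750 — 3 statements merged into one kernel-verified Lean document; each statement's English description precedes it below -/
import Mathlib

section
/- Let (S_n : n ≥ 0) be the M_d(d₁,d₂) balanced excited random walk with d₁ + d₂ > d and r := d₁ + d₂ − d. If d₁ − r ≥ 3, then the walk is transient: the number of times up to time n at which the walk moves in one of the first d₁ − r coordinates (coordinates 1,…,d−d₂) tends to infinity almost surely, and these moves form a symmetric random walk in at least 3 dimensions, so almost surely every site of ℤ^d is visited only finitely many times. -/
open MeasureTheory Filter

/-- The `i`-th canonical unit vector of `ℤ^d`. -/
def unitVec (d : ℕ) (i : Fin d) : Fin d → ℤ := fun j => if j = i then 1 else 0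

/-- `S` is a balanced excited random walk `M_d(d₁,d₂)` under `P`:
it starts at `0` a.s., is measurable, and conditionally on any finite trajectory
`S_0 = h 0, …, S_n = h n`, if `h n` is a new site the walk jumps to `h n ± e_i`
with probability `1/(2d₁)` for each `i < d₁` (`0`-indexed), while if `h n` is an
old site it jumps to `h n ± e_i` with probability `1/(2d₂)` for each
`d - d₂ ≤ i < d` (`0`-indexed). -/
def IsBERW {Ω : Type*} [MeasurableSpace Ω] (d d₁ d₂ : ℕ) (P : Measure Ω)
    (S : ℕ → Ω → Fin d → ℤ) : Prop :=
  (∀ n, Measurable (S n)) ∧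
  (∀ᵐ ω ∂P, S 0 ω = 0) ∧
  (∀ (n : ℕ) (h : ℕ → Fin d → ℤ), (∀ k < n, h n ≠ h k) →
    ∀ i : Fin d, i.1 < d₁ → ∀ ε : ℤ, ε = 1 ∨ ε = -1 →
      P {ω | (∀ k ≤ n, S k ω = h k) ∧ S (n + 1) ω = h n + ε • unitVec d i}
        = P {ω | ∀ k ≤ n, S k ω = h k} / (2 * d₁)) ∧
  (∀ (n : ℕ) (h : ℕ → Fin d → ℤ), (∃ k < n, h n = h k) →
    ∀ i : Fin d, d - d₂ ≤ i.1 → ∀ ε : ℤ, ε = 1 ∨ ε = -1 →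
      P {ω | (∀ k ≤ n, S k ω = h k) ∧ S (n + 1) ω = h n + ε • unitVec d i}
        = P {ω | ∀ k ≤ n, S k ω = h k} / (2 * d₂))

/-- Transience: almost surely, every site is visited only finitely many times. -/
def IsTransientWalk {Ω : Type*} [MeasurableSpace Ω] (d : ℕ) (P : Measure Ω)
    (S : ℕ → Ω → Fin d → ℤ) : Prop :=
  ∀ᵐ ω ∂P, ∀ x : Fin d → ℤ, {n : ℕ | S n ω = x}.Finite

open scoped Topology

section BalancedExcitedWalk

open Classical in
/-- The coordinate directions available to `M_d(d₁,d₂)` at time `n` along the trajectory `h`. -/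
noncomputable def stepDirs (d d₁ d₂ : ℕ) (h : ℕ → Fin d → ℤ) (n : ℕ) : Finset (Fin d) :=
  if ∀ k < n, h n ≠ h k then Finset.univ.filter (fun i => i.1 < d₁)
  else Finset.univ.filter (fun i => d - d₂ ≤ i.1)

/-- The signed directions available to `M_d(d₁,d₂)` at time `n` along the trajectory `h`. -/
noncomputable def signedDirs (d d₁ d₂ : ℕ) (h : ℕ → Fin d → ℤ) (n : ℕ) :
    Finset (Fin d × ℤ) :=
  stepDirs d d₁ d₂ h n ×ˢ {1, -1}

/-- The mean of `g (h n) y` when `y` is the position of `M_d(d₁,d₂)` one step after the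
trajectory `h 0, …, h n`. -/
noncomputable def stepMean (d d₁ d₂ : ℕ) (g : (Fin d → ℤ) → (Fin d → ℤ) → ℝ)
    (h : ℕ → Fin d → ℤ) (n : ℕ) : ℝ :=
  (∑ p ∈ signedDirs d d₁ d₂ h n, g (h n) (h n + p.2 • unitVec d p.1)) /
    (signedDirs d d₁ d₂ h n).card

variable {d d₁ d₂ : ℕ}

lemma stepDirs_of_new {h : ℕ → Fin d → ℤ} {n : ℕ} (H : ∀ k < n, h n ≠ h k) :
    stepDirs d d₁ d₂ h n = Finset.univ.filter (fun i => i.1 < d₁) := if_pos H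

lemma stepDirs_of_old {h : ℕ → Fin d → ℤ} {n : ℕ} (H : ¬ ∀ k < n, h n ≠ h k) :
    stepDirs d d₁ d₂ h n = Finset.univ.filter (fun i => d - d₂ ≤ i.1) := if_neg H

lemma stepDirs_congr {h h' : ℕ → Fin d → ℤ} {n : ℕ} (H : ∀ k ≤ n, h k = h' k) :
    stepDirs d d₁ d₂ h n = stepDirs d d₁ d₂ h' n := by
  have : (∀ k < n, h n ≠ h k) ↔ ∀ k < n, h' n ≠ h' k := by
    refine forall₂_congr fun k hk => ?_
    rw [H n le_rfl, H k hk.le]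
  simp only [stepDirs, this]

lemma stepMean_congr (g : (Fin d → ℤ) → (Fin d → ℤ) → ℝ) {h h' : ℕ → Fin d → ℤ} {n : ℕ}
    (H : ∀ k ≤ n, h k = h' k) : stepMean d d₁ d₂ g h n = stepMean d d₁ d₂ g h' n := by
  simp only [stepMean, signedDirs, stepDirs_congr H, H n le_rfl]

lemma card_filter_val_lt {m : ℕ} (hm : m ≤ d) :
    (Finset.univ.filter (fun i : Fin d => i.1 < m)).card = m := by
  rw [Fin.card_filter_val_lt, min_eq_right hm]

lemma card_filter_le_val (hd₂ : d₂ ≤ d) :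
    (Finset.univ.filter (fun i : Fin d => d - d₂ ≤ i.1)).card = d₂ := by
  have h := Finset.card_filter_add_card_filter_not (s := Finset.univ) fun i : Fin d => i.1 < d - d₂
  simp only [card_filter_val_lt (Nat.sub_le d d₂), not_lt, Finset.card_univ, Fintype.card_fin] at h
  omega

lemma card_signedDirs (h : ℕ → Fin d → ℤ) (n : ℕ) :
    (signedDirs d d₁ d₂ h n).card = (stepDirs d d₁ d₂ h n).card * 2 := by
  rw [signedDirs, Finset.card_product]
  rfl

lemma card_stepDirs_pos (hd₁ : 1 ≤ d₁) (hd₁' : d₁ ≤ d) (hd₂ : 1 ≤ d₂) (hd₂' : d₂ ≤ d)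
    (h : ℕ → Fin d → ℤ) (n : ℕ) : 0 < (stepDirs d d₁ d₂ h n).card := by
  by_cases H : ∀ k < n, h n ≠ h k
  · rw [stepDirs_of_new H, card_filter_val_lt hd₁']
    omega
  · rw [stepDirs_of_old H, card_filter_le_val hd₂']
    omega

lemma add_smul_unitVec_injOn (x : Fin d → ℤ) {p q : Fin d × ℤ} (hp : p.2 = 1 ∨ p.2 = -1)
    (h : x + p.2 • unitVec d p.1 = x + q.2 • unitVec d q.1) : p = q := by
  have h1 := congrFun (add_left_cancel h) p.1
  have hpq : p.1 = q.1 := by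
    by_contra hne
    simp only [Pi.smul_apply, unitVec, if_neg hne, if_true, smul_eq_mul] at h1
    omega
  refine Prod.ext hpq ?_
  simpa [unitVec, hpq] using h1

variable {Ω : Type*}

lemma pairwise_disjoint_step (S : ℕ → Ω → Fin d → ℤ) (n : ℕ) (h : ℕ → Fin d → ℤ) :
    Set.Pairwise (↑(signedDirs d d₁ d₂ h n)) (Function.onFun Disjoint fun p : Fin d × ℤ =>
      {ω | (∀ k ≤ n, S k ω = h k) ∧ S (n + 1) ω = h n + p.2 • unitVec d p.1}) := by
  intro p hp q _ hpq
  refine Set.disjoint_left.2 fun ω hω hω' => hpq ?_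
  simp only [signedDirs, Finset.coe_product, Set.mem_prod, Finset.mem_coe, Finset.mem_insert,
    Finset.mem_singleton] at hp
  exact add_smul_unitVec_injOn (h n) hp.2 (hω.2.symm.trans hω'.2)

/-- The trajectory up to time `n`. -/
def history (S : ℕ → Ω → Fin d → ℤ) (n : ℕ) (ω : Ω) : Fin (n + 1) → Fin d → ℤ :=
  fun k => S k ω

/-- The extension of a trajectory up to time `n` to an infinite trajectory, by a constant. -/
def extendHistory {n : ℕ} (v : Fin (n + 1) → Fin d → ℤ) : ℕ → Fin d → ℤ :=
  fun k => v ⟨min k n, by omega⟩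

lemma extendHistory_history (S : ℕ → Ω → Fin d → ℤ) {n k : ℕ} (hk : k ≤ n) (ω : Ω) :
    extendHistory (history S n ω) k = S k ω := by
  simp [extendHistory, history, min_eq_left hk]

lemma history_preimage_singleton (S : ℕ → Ω → Fin d → ℤ) (n : ℕ)
    (v : Fin (n + 1) → Fin d → ℤ) :
    history S n ⁻¹' {v} = {ω | ∀ k ≤ n, S k ω = extendHistory v k} := by
  ext ω
  simp only [Set.mem_preimage, Set.mem_singleton_iff, Set.mem_ofPred_eq]
  constructor
  · rintro rfl k hk
    exact (extendHistory_history S hk ω).symm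
  · intro H
    funext k
    have := H k (by omega)
    rw [history, this, extendHistory]
    congr 1
    ext
    simp only [inf_eq_left]
    omega

variable [MeasurableSpace Ω] {P : Measure Ω} {S : ℕ → Ω → Fin d → ℤ}

lemma IsBERW.measure_step (hS : IsBERW d d₁ d₂ P S) (hd₁' : d₁ ≤ d) (hd₂' : d₂ ≤ d)
    (n : ℕ) (h : ℕ → Fin d → ℤ) {p : Fin d × ℤ} (hp : p ∈ signedDirs d d₁ d₂ h n) :
    P {ω | (∀ k ≤ n, S k ω = h k) ∧ S (n + 1) ω = h n + p.2 • unitVec d p.1}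
      = P {ω | ∀ k ≤ n, S k ω = h k} / (signedDirs d d₁ d₂ h n).card := by
  rw [card_signedDirs]
  simp only [signedDirs, Finset.mem_product, Finset.mem_insert, Finset.mem_singleton] at hp
  by_cases H : ∀ k < n, h n ≠ h k
  · rw [stepDirs_of_new H] at hp ⊢
    rw [hS.2.2.1 n h H p.1 (by simpa using hp.1) p.2 hp.2, card_filter_val_lt hd₁', mul_comm]
    push_cast
    rfl
  · rw [stepDirs_of_old H] at hp ⊢
    rw [hS.2.2.2 n h (by push Not at H; exact H) p.1 (by simpa using hp.1) p.2 hp.2,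
      card_filter_le_val hd₂', mul_comm]
    push_cast
    rfl

lemma IsBERW.measurableSet_history (hS : IsBERW d d₁ d₂ P S) (n : ℕ) (h : ℕ → Fin d → ℤ) :
    MeasurableSet {ω | ∀ k ≤ n, S k ω = h k} := by
  have : {ω | ∀ k ≤ n, S k ω = h k} = ⋂ k, ⋂ (_ : k ≤ n), S k ⁻¹' {h k} := by
    ext; simp
  rw [this]
  exact MeasurableSet.iInter fun k => MeasurableSet.iInter fun _ =>
    hS.1 k (measurableSet_singleton _)

lemma IsBERW.measurableSet_step (hS : IsBERW d d₁ d₂ P S) (n : ℕ) (h : ℕ → Fin d → ℤ)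
    (y : Fin d → ℤ) : MeasurableSet {ω | (∀ k ≤ n, S k ω = h k) ∧ S (n + 1) ω = y} :=
  (hS.measurableSet_history n h).inter (hS.1 (n + 1) (measurableSet_singleton y))

/-- Up to a null set, a history is the disjoint union of its one-step extensions. -/
lemma IsBERW.iUnion_step_ae_eq [IsProbabilityMeasure P] (hS : IsBERW d d₁ d₂ P S)
    (hd₁ : 1 ≤ d₁) (hd₁' : d₁ ≤ d) (hd₂ : 1 ≤ d₂) (hd₂' : d₂ ≤ d)
    (n : ℕ) (h : ℕ → Fin d → ℤ) :
    (⋃ p ∈ signedDirs d d₁ d₂ h n,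
      {ω | (∀ k ≤ n, S k ω = h k) ∧ S (n + 1) ω = h n + p.2 • unitVec d p.1} : Set Ω)
      =ᵐ[P] {ω | ∀ k ≤ n, S k ω = h k} := by
  have hpos := card_stepDirs_pos hd₁ hd₁' hd₂ hd₂' h n
  refine ae_eq_of_subset_of_measure_ge ?_ ?_ ?_ (measure_ne_top _ _)
  · simp only [Set.iUnion_subset_iff]
    exact fun p _ ω hω => hω.1
  · rw [measure_biUnion_finset (pairwise_disjoint_step S n h)
      (fun p _ => hS.measurableSet_step n h _),
      Finset.sum_congr rfl fun p hp => hS.measure_step hd₁' hd₂' n h hp, Finset.sum_const,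
      nsmul_eq_mul, ENNReal.mul_div_cancel]
    · rw [card_signedDirs]
      simp only [ne_eq, Nat.cast_eq_zero]
      omega
    · simp
  · exact (Finset.measurableSet_biUnion _
      fun p _ => hS.measurableSet_step n h _).nullMeasurableSet

lemma IsBERW.measurable_history (hS : IsBERW d d₁ d₂ P S) (n : ℕ) :
    @Measurable _ _ _ ⊤ (history S n) := by
  refine @measurable_to_countable' _ _ ⊤ _ _ _ fun v => ?_
  rw [history_preimage_singleton]
  exact hS.measurableSet_history n _

/-- The filtration generated by the walk. -/
def IsBERW.filtration (hS : IsBERW d d₁ d₂ P S) : Filtration ℕ ‹MeasurableSpace Ω› where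
  seq n := MeasurableSpace.comap (history S n) ⊤
  mono' n m hnm := by
    rintro _ ⟨A, -, rfl⟩
    exact ⟨{v | (fun k : Fin (n + 1) => v ⟨k, by omega⟩) ∈ A}, trivial, rfl⟩
  le' n := (hS.measurable_history n).comap_le

/-- A function of the trajectory up to time `n` is measurable with respect to the past. -/
lemma IsBERW.stronglyMeasurable_of_history (hS : IsBERW d d₁ d₂ P S) (n : ℕ)
    (Φ : (ℕ → Fin d → ℤ) → ℝ) (hΦ : ∀ h h', (∀ k ≤ n, h k = h' k) → Φ h = Φ h') :
    StronglyMeasurable[hS.filtration n] (fun ω => Φ (fun k => S k ω)) := by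
  have heq : (fun ω => Φ (fun k => S k ω)) = (fun v => Φ (extendHistory v)) ∘ history S n := by
    funext ω
    exact hΦ _ _ fun k hk => (extendHistory_history S hk ω).symm
  have hmeas : Measurable[hS.filtration n] (fun ω => Φ (fun k => S k ω)) := by
    rw [heq]
    exact fun t _ => ⟨(fun v => Φ (extendHistory v)) ⁻¹' t, trivial, rfl⟩
  exact hmeas.stronglyMeasurable

/-- Almost surely, every step follows an available direction. -/
lemma IsBERW.ae_step [IsProbabilityMeasure P] (hS : IsBERW d d₁ d₂ P S)
    (hd₁ : 1 ≤ d₁) (hd₁' : d₁ ≤ d) (hd₂ : 1 ≤ d₂) (hd₂' : d₂ ≤ d) :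
    ∀ᵐ ω ∂P, ∀ n, ∃ p ∈ signedDirs d d₁ d₂ (fun k => S k ω) n,
      S (n + 1) ω = S n ω + p.2 • unitVec d p.1 := by
  refine ae_all_iff.2 fun n => ?_
  have key : ∀ᵐ ω ∂P, ∀ v : Fin (n + 1) → Fin d → ℤ,
      (∀ k ≤ n, S k ω = extendHistory v k) → ∃ p ∈ signedDirs d d₁ d₂ (extendHistory v) n,
      S (n + 1) ω = extendHistory v n + p.2 • unitVec d p.1 := by
    refine ae_all_iff.2 fun v => ?_
    filter_upwards [(hS.iUnion_step_ae_eq hd₁ hd₁' hd₂ hd₂' n (extendHistory v)).mem_iff]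
      with ω hω H
    have := hω.2 H
    simp only [Set.mem_iUnion, Set.mem_ofPred_eq, exists_prop] at this
    obtain ⟨p, hp, -, h2⟩ := this
    exact ⟨p, hp, h2⟩
  filter_upwards [key] with ω hω
  obtain ⟨p, hp, h2⟩ := hω (history S n ω) fun k hk => (extendHistory_history S hk ω).symm
  refine ⟨p, ?_, ?_⟩
  · rw [signedDirs, stepDirs_congr (h' := extendHistory (history S n ω))
      fun k hk => (extendHistory_history S hk ω).symm]
    exact hp
  · rwa [extendHistory_history S le_rfl] at h2

lemma IsBERW.measurable_pair (hS : IsBERW d d₁ d₂ P S)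
    (g : (Fin d → ℤ) → (Fin d → ℤ) → ℝ) (n : ℕ) :
    Measurable fun ω => g (S n ω) (S (n + 1) ω) :=
  (measurable_of_countable (Function.uncurry g)).comp ((hS.1 n).prodMk (hS.1 (n + 1)))

lemma IsBERW.integrable_pair [IsProbabilityMeasure P] (hS : IsBERW d d₁ d₂ P S)
    (hd₁ : 1 ≤ d₁) (hd₁' : d₁ ≤ d) (hd₂ : 1 ≤ d₂) (hd₂' : d₂ ≤ d)
    {g : (Fin d → ℤ) → (Fin d → ℤ) → ℝ} {C : ℝ}
    (hg : ∀ x i ε, ε = 1 ∨ ε = -1 → |g x (x + ε • unitVec d i)| ≤ C) (n : ℕ) :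
    Integrable (fun ω => g (S n ω) (S (n + 1) ω)) P := by
  refine Integrable.of_bound (hS.measurable_pair g n).aestronglyMeasurable C ?_
  filter_upwards [hS.ae_step hd₁ hd₁' hd₂ hd₂'] with ω hω
  obtain ⟨p, hp, h2⟩ := hω n
  simp only [signedDirs, Finset.mem_product, Finset.mem_insert, Finset.mem_singleton] at hp
  rw [h2]
  exact hg _ _ _ hp.2

lemma abs_stepMean_le {g : (Fin d → ℤ) → (Fin d → ℤ) → ℝ} {C : ℝ} (hC : 0 ≤ C)
    (hg : ∀ x i ε, ε = 1 ∨ ε = -1 → |g x (x + ε • unitVec d i)| ≤ C)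
    (h : ℕ → Fin d → ℤ) (n : ℕ) : |stepMean d d₁ d₂ g h n| ≤ C := by
  rw [stepMean, abs_div, Nat.abs_cast]
  refine div_le_of_le_mul₀ (Nat.cast_nonneg _) hC ?_
  refine (Finset.abs_sum_le_sum_abs _ _).trans ?_
  refine (Finset.sum_le_card_nsmul _ _ C fun p hp => ?_).trans_eq ?_
  · simp only [signedDirs, Finset.mem_product, Finset.mem_insert, Finset.mem_singleton] at hp
    exact hg _ _ _ hp.2
  · rw [nsmul_eq_mul, mul_comm]

lemma IsBERW.setIntegral_history [IsProbabilityMeasure P] (hS : IsBERW d d₁ d₂ P S)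
    (hd₁ : 1 ≤ d₁) (hd₁' : d₁ ≤ d) (hd₂ : 1 ≤ d₂) (hd₂' : d₂ ≤ d)
    {g : (Fin d → ℤ) → (Fin d → ℤ) → ℝ} {C : ℝ}
    (hg : ∀ x i ε, ε = 1 ∨ ε = -1 → |g x (x + ε • unitVec d i)| ≤ C)
    (n : ℕ) (h : ℕ → Fin d → ℤ) :
    ∫ ω in {ω | ∀ k ≤ n, S k ω = h k}, stepMean d d₁ d₂ g (fun k => S k ω) n ∂P
      = ∫ ω in {ω | ∀ k ≤ n, S k ω = h k}, g (S n ω) (S (n + 1) ω) ∂P := by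
  have hint := hS.integrable_pair hd₁ hd₁' hd₂ hd₂' hg n
  rw [setIntegral_congr_fun (g := fun _ => stepMean d d₁ d₂ g h n)
      (hS.measurableSet_history n h) (fun ω hω => stepMean_congr g hω),
    setIntegral_const, ← setIntegral_congr_set (hS.iUnion_step_ae_eq hd₁ hd₁' hd₂ hd₂' n h),
    integral_biUnion_finset _ (fun p _ => hS.measurableSet_step n h _)
      (pairwise_disjoint_step S n h) (fun p _ => hint.integrableOn),
    stepMean, smul_eq_mul, mul_div_assoc', mul_comm, mul_div_assoc, Finset.sum_mul]
  refine Finset.sum_congr rfl fun p hp => ?_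
  rw [setIntegral_congr_fun (g := fun _ => g (h n) (h n + p.2 • unitVec d p.1))
      (hS.measurableSet_step n h _) (fun ω hω => ?_), setIntegral_const, smul_eq_mul, mul_comm]
  · rw [Measure.real, Measure.real, hS.measure_step hd₁' hd₂' n h hp, ENNReal.toReal_div,
      ENNReal.toReal_natCast]
  · simp only [hω.2, hω.1 n le_rfl]

/-- The conditional law of a step given the past. -/
lemma IsBERW.condExp_pair [IsProbabilityMeasure P] (hS : IsBERW d d₁ d₂ P S)
    (hd₁ : 1 ≤ d₁) (hd₁' : d₁ ≤ d) (hd₂ : 1 ≤ d₂) (hd₂' : d₂ ≤ d)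
    {g : (Fin d → ℤ) → (Fin d → ℤ) → ℝ} {C : ℝ} (hC : 0 ≤ C)
    (hg : ∀ x i ε, ε = 1 ∨ ε = -1 → |g x (x + ε • unitVec d i)| ≤ C) (n : ℕ) :
    (fun ω => stepMean d d₁ d₂ g (fun k => S k ω) n)
      =ᵐ[P] P[fun ω => g (S n ω) (S (n + 1) ω) | hS.filtration n] := by
  have hsm := hS.stronglyMeasurable_of_history n (fun h => stepMean d d₁ d₂ g h n)
    (fun _ _ H => stepMean_congr g H)
  have hint : Integrable (fun ω => stepMean d d₁ d₂ g (fun k => S k ω) n) P :=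
    Integrable.of_bound (hsm.mono (hS.filtration.le n)).aestronglyMeasurable C
      (ae_of_all _ fun ω => abs_stepMean_le hC hg _ _)
  have hint' := hS.integrable_pair hd₁ hd₁' hd₂ hd₂' hg n
  refine ae_eq_condExp_of_forall_setIntegral_eq (hS.filtration.le n) hint'
    (fun s _ _ => hint.integrableOn) ?_ hsm.aestronglyMeasurable
  rintro _ ⟨A, -, rfl⟩ -
  have hA : history S n ⁻¹' A = ⋃ v : A, history S n ⁻¹' {v.1} := by
    ext; simp
  have hdisj : Pairwise (Function.onFun Disjoint fun v : A => history S n ⁻¹' {v.1}) :=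
    fun v w hvw => Disjoint.preimage _ (by simpa [Subtype.ext_iff] using hvw)
  have hmeas : ∀ v : A, MeasurableSet (history S n ⁻¹' {v.1}) := fun v => by
    rw [history_preimage_singleton]
    exact hS.measurableSet_history n _
  rw [hA, integral_iUnion hmeas hdisj hint.integrableOn,
    integral_iUnion hmeas hdisj hint'.integrableOn]
  refine tsum_congr fun v => ?_
  rw [history_preimage_singleton]
  exact hS.setIntegral_history hd₁ hd₁' hd₂ hd₂' hg n _

/-- An event for one step that is possible infinitely often occurs infinitely often. -/
lemma IsBERW.ae_frequently_step [IsProbabilityMeasure P] (hS : IsBERW d d₁ d₂ P S)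
    (hd₁ : 1 ≤ d₁) (hd₁' : d₁ ≤ d) (hd₂ : 1 ≤ d₂) (hd₂' : d₂ ≤ d)
    (A : (Fin d → ℤ) → (Fin d → ℤ) → Prop) :
    ∀ᵐ ω ∂P, (∃ᶠ k in atTop, ∃ p ∈ signedDirs d d₁ d₂ (fun k => S k ω) k,
      A (S k ω) (S k ω + p.2 • unitVec d p.1)) → ∃ᶠ k in atTop, A (S k ω) (S (k + 1) ω) := by
  classical
  set g : (Fin d → ℤ) → (Fin d → ℤ) → ℝ := fun x y => if A x y then 1 else 0 with hgdef
  have hg0 : ∀ x y, 0 ≤ g x y := fun x y => by simp only [hgdef]; split_ifs <;> norm_num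
  have hg : ∀ x i ε, ε = 1 ∨ ε = -1 → |g x (x + ε • unitVec d i)| ≤ 1 := fun x i ε _ => by
    simp only [hgdef]; split_ifs <;> norm_num
  let s : ℕ → Set Ω := fun n => n.casesOn ∅ fun k => {ω | A (S k ω) (S (k + 1) ω)}
  have hind : ∀ k, (s (k + 1)).indicator (1 : Ω → ℝ) = fun ω => g (S k ω) (S (k + 1) ω) := by
    intro k
    funext ω
    simp only [s, hgdef, Set.indicator_apply, Set.mem_ofPred_eq, Pi.one_apply]
  have hs : ∀ n, MeasurableSet[hS.filtration n] (s n) := by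
    rintro (_ | k)
    · exact @MeasurableSet.empty _ (hS.filtration 0)
    · exact ⟨{v | A (v ⟨k, by omega⟩) (v ⟨k + 1, by omega⟩)}, trivial, rfl⟩
  have hcond := ae_all_iff.2 fun n => hS.condExp_pair hd₁ hd₁' hd₂ hd₂' zero_le_one hg n
  have hdpos : (0 : ℝ) < 1 / (2 * d) := by
    have : 0 < d := by omega
    positivity
  filter_upwards [ae_mem_limsup_atTop_iff P hs, hcond] with ω hlevy hω hfreq
  have hlim : ω ∈ limsup s atTop := by
    rw [hlevy]
    let t : ℕ → Set Ω := fun k => {ω | ∃ p ∈ signedDirs d d₁ d₂ (fun k => S k ω) k,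
      A (S k ω) (S k ω + p.2 • unitVec d p.1)}
    have hω' : ω ∈ limsup t atTop := mem_limsup_iff_frequently_mem.2 hfreq
    rw [Set.limsup_eq_tendsto_sum_indicator_atTop hdpos] at hω'
    refine tendsto_atTop_mono (fun n => Finset.sum_le_sum fun k _ => ?_) hω'
    rw [hind k, ← hω k]
    by_cases hk : ∃ p ∈ signedDirs d d₁ d₂ (fun k => S k ω) k,
        A (S k ω) (S k ω + p.2 • unitVec d p.1)
    · rw [Set.indicator_of_mem (by exact hk)]
      obtain ⟨p, hp, hpA⟩ := hk
      have hcard : (signedDirs d d₁ d₂ (fun k => S k ω) k).card ≤ 2 * d := by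
        rw [card_signedDirs, mul_comm]
        exact Nat.mul_le_mul_left _ ((Finset.card_le_univ _).trans_eq (Fintype.card_fin d))
      have hcard' : 0 < (signedDirs d d₁ d₂ (fun k => S k ω) k).card :=
        Finset.card_pos.2 ⟨p, hp⟩
      have hsum : (1 : ℝ) ≤ ∑ p ∈ signedDirs d d₁ d₂ (fun k => S k ω) k,
          g (S k ω) (S k ω + p.2 • unitVec d p.1) := by
        refine le_trans (by simp only [hgdef, if_pos hpA]; exact le_rfl)
          (Finset.single_le_sum (fun q _ => hg0 _ _) hp)
      exact div_le_div₀ (by linarith) hsum (by exact_mod_cast hcard') (by exact_mod_cast hcard)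
    · rw [Set.indicator_of_notMem (by exact hk)]
      exact div_nonneg (Finset.sum_nonneg fun q _ => hg0 _ _) (Nat.cast_nonneg _)
  rw [mem_limsup_iff_frequently_mem, ← map_add_atTop_eq_nat 1] at hlim
  exact hlim

lemma IsBERW.ae_abs_coord_le [IsProbabilityMeasure P] (hS : IsBERW d d₁ d₂ P S)
    (hd₁ : 1 ≤ d₁) (hd₁' : d₁ ≤ d) (hd₂ : 1 ≤ d₂) (hd₂' : d₂ ≤ d) (i : Fin d) :
    ∀ᵐ ω ∂P, ∀ n, |(S n ω i : ℝ)| ≤ n ∧ |(S (n + 1) ω i : ℝ) - S n ω i| ≤ 1 := by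
  filter_upwards [hS.2.1, hS.ae_step hd₁ hd₁' hd₂ hd₂'] with ω h0 hstep
  have hincr : ∀ n, |(S (n + 1) ω i : ℝ) - S n ω i| ≤ 1 := by
    intro n
    obtain ⟨p, hp, h2⟩ := hstep n
    simp only [signedDirs, Finset.mem_product, Finset.mem_insert, Finset.mem_singleton] at hp
    rw [h2]
    simp only [Pi.add_apply, Pi.smul_apply, unitVec, smul_eq_mul]
    rcases hp.2 with h | h <;> rw [h] <;> split_ifs <;> simp
  intro n
  refine ⟨?_, hincr n⟩
  induction n with
  | zero => simp [h0]
  | succ n ih =>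
    have := abs_add_le (S n ω i : ℝ) ((S (n + 1) ω i : ℝ) - S n ω i)
    rw [add_sub_cancel] at this
    push_cast
    linarith [hincr n]

lemma stepMean_sub_eq_zero (i : Fin d) (h : ℕ → Fin d → ℤ) (n : ℕ) :
    stepMean d d₁ d₂ (fun x y => (y i : ℝ) - x i) h n = 0 := by
  rw [stepMean, signedDirs, Finset.sum_product, Finset.sum_eq_zero, zero_div]
  intro j _
  rw [Finset.sum_pair (by norm_num)]
  simp only [Pi.add_apply, Pi.smul_apply, unitVec, smul_eq_mul]
  push_cast
  ring

lemma IsBERW.martingale_coord [IsProbabilityMeasure P] (hS : IsBERW d d₁ d₂ P S)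
    (hd₁ : 1 ≤ d₁) (hd₁' : d₁ ≤ d) (hd₂ : 1 ≤ d₂) (hd₂' : d₂ ≤ d) (i : Fin d) :
    Martingale (fun n ω => (S n ω i : ℝ)) hS.filtration P := by
  have hmeas : ∀ n, StronglyMeasurable[hS.filtration n] (fun ω => (S n ω i : ℝ)) := fun n =>
    hS.stronglyMeasurable_of_history n (fun h => (h n i : ℝ)) fun h h' H => by
      simp only [H n le_rfl]
  refine martingale_of_condExp_sub_eq_zero_nat hmeas (fun n => ?_) fun n => ?_
  · refine Integrable.of_bound ((hmeas n).mono (hS.filtration.le n)).aestronglyMeasurable n ?_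
    filter_upwards [hS.ae_abs_coord_le hd₁ hd₁' hd₂ hd₂' i] with ω hω
    exact (hω n).1
  · have hg : ∀ (x : Fin d → ℤ) (j : Fin d) (ε : ℤ), ε = 1 ∨ ε = -1 →
        |((x + ε • unitVec d j) i : ℝ) - x i| ≤ 1 := by
      intro x j ε hε
      simp only [Pi.add_apply, Pi.smul_apply, unitVec, smul_eq_mul]
      rcases hε with h | h <;> rw [h] <;> split_ifs <;> simp
    have h := hS.condExp_pair hd₁ hd₁' hd₂ hd₂'
      (g := fun x y => (y i : ℝ) - x i) zero_le_one hg n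
    simp only [stepMean_sub_eq_zero] at h
    exact h.symm

/-- A convergent sequence of integers is eventually constant. -/
lemma eventually_succ_eq_of_tendsto {z : ℕ → ℤ} {c : ℝ}
    (hz : Tendsto (fun n => (z n : ℝ)) atTop (𝓝 c)) : ∀ᶠ n in atTop, z (n + 1) = z n := by
  have h := ((hz.comp (tendsto_add_atTop_nat 1)).sub hz).abs
  rw [sub_self, abs_zero] at h
  filter_upwards [h.eventually (gt_mem_nhds (zero_lt_one (α := ℝ)))] with n hn
  simp only [Function.comp_apply] at hn
  have : |z (n + 1) - z n| < 1 := by exact_mod_cast hn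
  have := Int.abs_lt_one_iff.1 this
  omega

/-- Almost surely, the walk visits infinitely many sites. -/
lemma IsBERW.ae_infinite_range [IsProbabilityMeasure P] (hS : IsBERW d d₁ d₂ P S)
    (hd₁ : 1 ≤ d₁) (hd₁' : d₁ ≤ d) (hd₂ : 1 ≤ d₂) (hd₂' : d₂ ≤ d) (hover : d < d₁ + d₂) :
    ∀ᵐ ω ∂P, (Set.range fun n => S n ω).Infinite := by
  set i : Fin d := ⟨d - d₂, by omega⟩ with hi
  have hbdd : ∀ᵐ ω ∂P, ∀ n, |(S (n + 1) ω i : ℝ) - S n ω i| ≤ (1 : NNReal) := by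
    filter_upwards [hS.ae_abs_coord_le hd₁ hd₁' hd₂ hd₂' i] with ω hω n
    exact (hω n).2
  filter_upwards [(hS.martingale_coord hd₁ hd₁' hd₂ hd₂' i).submartingale.bddAbove_iff_exists_tendsto
    hbdd, hS.ae_frequently_step hd₁ hd₁' hd₂ hd₂' (fun x y => y i ≠ x i)] with ω hconv hfreq hfin
  have hbd : BddAbove (Set.range fun n => (S n ω i : ℝ)) := by
    have := hfin.image fun x => (x i : ℝ)
    rw [← Set.range_comp] at this
    exact this.bddAbove
  obtain ⟨c, hc⟩ := hconv.1 hbd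
  refine hfreq (Eventually.frequently (Eventually.of_forall fun k => ⟨(i, 1), ?_, ?_⟩)) ?_
  · simp only [signedDirs, Finset.mem_product, Finset.mem_insert, true_or, and_true]
    by_cases H : ∀ j < k, S k ω ≠ S j ω
    · rw [stepDirs_of_new H]
      simp only [Finset.mem_filter, Finset.mem_univ, true_and, hi]
      omega
    · rw [stepDirs_of_old H]
      simp only [Finset.mem_filter, Finset.mem_univ, true_and, hi, le_refl]
  · simp [unitVec]
  · filter_upwards [eventually_succ_eq_of_tendsto hc] with n hn using not_not.2 hn

/-- A sequence with infinite range takes new values infinitely often. -/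
lemma frequently_new_of_infinite_range {α : Type*} {u : ℕ → α} (hu : (Set.range u).Infinite) :
    ∃ᶠ n in atTop, ∀ k < n, u n ≠ u k := by
  rw [frequently_atTop]
  by_contra! hcon
  obtain ⟨N, hN⟩ := hcon
  refine hu (((Set.finite_lt_nat N).image u).subset ?_)
  rintro _ ⟨n, rfl⟩
  induction n using Nat.strong_induction_on with
  | _ n ih =>
    rcases lt_or_ge n N with h | h
    · exact ⟨n, h, rfl⟩
    · obtain ⟨k, hk, hku⟩ := hN n h
      rw [hku]
      exact ih k hk

/-- Almost surely, the walk moves in the first `d - d₂` coordinates infinitely often. -/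
lemma IsBERW.ae_frequently_move [IsProbabilityMeasure P] (hS : IsBERW d d₁ d₂ P S)
    (hd₁ : 1 ≤ d₁) (hd₁' : d₁ ≤ d) (hd₂ : 1 ≤ d₂) (hd₂' : d₂ < d) (hover : d < d₁ + d₂) :
    ∀ᵐ ω ∂P, ∃ᶠ k in atTop, ∃ i : Fin d, i.1 < d - d₂ ∧ S (k + 1) ω i ≠ S k ω i := by
  filter_upwards [hS.ae_infinite_range hd₁ hd₁' hd₂ hd₂'.le hover,
    hS.ae_frequently_step hd₁ hd₁' hd₂ hd₂'.le
      (fun x y => ∃ i : Fin d, i.1 < d - d₂ ∧ y i ≠ x i)] with ω hinf hfreq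
  refine hfreq ((frequently_new_of_infinite_range hinf).mono fun k hk => ?_)
  refine ⟨(⟨0, by omega⟩, 1), ?_, ⟨0, by omega⟩, ?_, ?_⟩
  · rw [signedDirs, stepDirs_of_new hk]
    simp only [Finset.mem_product, Finset.mem_filter, Finset.mem_univ, true_and,
      Finset.mem_insert, true_or, and_true]
    omega
  · simp only
    omega
  · simp [unitVec]

lemma tendsto_card_filter_range_atTop {p : ℕ → Prop} [DecidablePred p]
    (hp : ∃ᶠ k in atTop, p k) :
    Tendsto (fun n => ((Finset.range n).filter p).card) atTop atTop := by
  refine tendsto_atTop_atTop_of_monotone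
    (fun m n h => Finset.card_le_card (Finset.filter_subset_filter _ (Finset.range_mono h))) ?_
  intro b
  obtain ⟨t, ht, hcard⟩ := (Nat.frequently_atTop_iff_infinite.1 hp).exists_subset_card_eq b
  refine ⟨t.sup id + 1, hcard ▸ Finset.card_le_card fun k hk => ?_⟩
  rw [Finset.mem_filter, Finset.mem_range]
  exact ⟨Nat.lt_succ_of_le (Finset.le_sup (f := id) hk), ht hk⟩

/-- The squared Euclidean norm of the first `m` coordinates. -/
def firstNormSq {d : ℕ} (m : ℕ) (x : Fin d → ℤ) : ℤ :=
  ∑ i ∈ Finset.univ.filter (fun i : Fin d => i.1 < m), x i ^ 2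

/-- A positive function of the first `m` coordinates, superharmonic when `3 ≤ m`. -/
noncomputable def lyapunov {d : ℕ} (m : ℕ) (x : Fin d → ℤ) : ℝ :=
  (√√(110 + firstNormSq m x))⁻¹

lemma firstNormSq_nonneg {d : ℕ} (m : ℕ) (x : Fin d → ℤ) : 0 ≤ firstNormSq m x :=
  Finset.sum_nonneg fun _ _ => sq_nonneg _

lemma firstNormSq_add_of_not_lt {d m : ℕ} (x : Fin d → ℤ) {i : Fin d} (hi : ¬ i.1 < m) (ε : ℤ) :
    firstNormSq m (x + ε • unitVec d i) = firstNormSq m x := by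
  refine Finset.sum_congr rfl fun j hj => ?_
  have hji : j ≠ i := by
    rintro rfl
    exact hi (by simpa using hj)
  simp [unitVec, hji]

lemma firstNormSq_add_of_lt {d m : ℕ} (x : Fin d → ℤ) {i : Fin d} (hi : i.1 < m) {ε : ℤ}
    (hε : ε = 1 ∨ ε = -1) :
    firstNormSq m (x + ε • unitVec d i) = firstNormSq m x + (1 + 2 * ε * x i) := by
  have hmem : i ∈ Finset.univ.filter (fun i : Fin d => i.1 < m) := by simpa using hi
  rw [firstNormSq, firstNormSq, ← Finset.add_sum_erase _ _ hmem, ← Finset.add_sum_erase _ _ hmem,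
    Finset.sum_congr rfl fun j hj => show (x + ε • unitVec d i) j ^ 2 = x j ^ 2 by
      simp [unitVec, Finset.ne_of_mem_erase hj]]
  simp only [Pi.add_apply, Pi.smul_apply, unitVec, if_true, smul_eq_mul]
  rcases hε with rfl | rfl <;> ring

lemma lyapunov_pos {d : ℕ} (m : ℕ) (x : Fin d → ℤ) : 0 < lyapunov m x := by
  have : (0 : ℝ) ≤ firstNormSq m x := by exact_mod_cast firstNormSq_nonneg m x
  unfold lyapunov
  positivity

lemma lyapunov_le_one {d : ℕ} (m : ℕ) (x : Fin d → ℤ) : lyapunov m x ≤ 1 := by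
  have : (0 : ℝ) ≤ firstNormSq m x := by exact_mod_cast firstNormSq_nonneg m x
  refine inv_le_one_of_one_le₀ ?_
  rw [Real.one_le_sqrt, Real.one_le_sqrt]
  linarith

lemma lyapunov_inv_pow {d : ℕ} (m : ℕ) (x : Fin d → ℤ) :
    (lyapunov m x)⁻¹ ^ 4 = 110 + firstNormSq m x := by
  have : (0 : ℝ) ≤ firstNormSq m x := by exact_mod_cast firstNormSq_nonneg m x
  rw [lyapunov, inv_inv, show 4 = 2 * 2 by norm_num, pow_mul, Real.sq_sqrt (by positivity),
    Real.sq_sqrt (by positivity)]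

/-- A quadratic upper bound for `t ↦ t ^ (-1/4)` near `a`. -/
lemma inv_sqrt_sqrt_add_le {a δ : ℝ} (ha : 0 < a) (hδ : |δ| ≤ a / 10) :
    (√√(a + δ))⁻¹ ≤ (√√a)⁻¹ * (1 - δ / a / 4 + 3 / 16 * (δ / a) ^ 2) := by
  set y := δ / a with hy
  have hya : |y| ≤ 1 / 10 := by
    rw [hy, abs_div, abs_of_pos ha, div_le_iff₀ ha]
    linarith
  obtain ⟨hy1, hy2⟩ := abs_le.1 hya
  have hadd : a + δ = a * (1 + y) := by
    rw [hy]
    field_simp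
  rw [hadd, Real.sqrt_mul ha.le, Real.sqrt_mul (Real.sqrt_nonneg _), mul_inv]
  refine mul_le_mul_of_nonneg_left ?_ (by positivity)
  have hq : 0 < 1 - y / 4 + 3 / 16 * y ^ 2 := by nlinarith
  have hw : 0 < √√(1 + y) := Real.sqrt_pos.2 (Real.sqrt_pos.2 (by linarith))
  have hw4 : √√(1 + y) ^ 4 = 1 + y := by
    rw [show 4 = 2 * 2 by norm_num, pow_mul, Real.sq_sqrt (by positivity),
      Real.sq_sqrt (by linarith)]
  rw [inv_le_iff_one_le_mul₀' hw]
  refine (pow_le_pow_iff_left₀ zero_le_one (by positivity) (n := 4) (by norm_num)).1 ?_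
  rw [mul_pow, hw4, one_pow]
  have hrem : 0 ≤ 91 / 256 - 30 / 256 * y
      + y ^ 2 * (81 / 2048 - 27 / 4096 * y + 81 / 65536 * y ^ 2) :=
    add_nonneg (by linarith) (mul_nonneg (sq_nonneg y) (by nlinarith))
  have hq4 : 1 - y + 9 / 8 * y ^ 2 - 5 / 8 * y ^ 3 ≤ (1 - y / 4 + 3 / 16 * y ^ 2) ^ 4 := by
    have := mul_nonneg (pow_nonneg (sq_nonneg y) 2) hrem
    linarith
  have hmul : 0 ≤ y ^ 2 * (1 / 8 + y / 2 - 5 / 8 * y ^ 2) :=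
    mul_nonneg (sq_nonneg y) (by nlinarith)
  have := mul_le_mul_of_nonneg_left hq4 (show 0 ≤ 1 + y by linarith)
  linarith

lemma lyapunov_step_le {d m : ℕ} (x : Fin d → ℤ) {i : Fin d} (hi : i.1 < m) {ε : ℤ}
    (hε : ε = 1 ∨ ε = -1) :
    lyapunov m (x + ε • unitVec d i) ≤ lyapunov m x *
      (1 - (1 + 2 * ε * x i) / (110 + firstNormSq m x) / 4
        + 3 / 16 * ((1 + 2 * ε * x i) / (110 + firstNormSq m x)) ^ 2) := by
  have h0 : (0 : ℝ) ≤ firstNormSq m x := by exact_mod_cast firstNormSq_nonneg m x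
  have hxi : (x i : ℝ) ^ 2 ≤ firstNormSq m x := by
    have : x i ^ 2 ≤ firstNormSq m x := Finset.single_le_sum (f := fun i => x i ^ 2)
      (fun _ _ => sq_nonneg _) (by simpa using hi)
    exact_mod_cast this
  rw [lyapunov, lyapunov, firstNormSq_add_of_lt x hi hε]
  push_cast
  rw [← add_assoc]
  refine inv_sqrt_sqrt_add_le (by linarith) ?_
  rcases hε with rfl | rfl <;> push_cast <;> rw [abs_le] <;> constructor <;>
    nlinarith [sq_nonneg ((x i : ℝ) - 10), sq_nonneg ((x i : ℝ) + 10)]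

lemma sum_lyapunov_sub_nonpos {d m : ℕ} (hm : 3 ≤ m) (hmd : m ≤ d) (x : Fin d → ℤ) :
    ∑ i ∈ Finset.univ.filter (fun i : Fin d => i.1 < m),
      (lyapunov m (x + (1 : ℤ) • unitVec d i) + lyapunov m (x + (-1 : ℤ) • unitVec d i)
        - 2 * lyapunov m x) ≤ 0 := by
  set a : ℝ := 110 + firstNormSq m x with ha
  have h0 : (0 : ℝ) ≤ firstNormSq m x := by exact_mod_cast firstNormSq_nonneg m x
  have hapos : 0 < a := by positivity
  have hbound : ∀ i ∈ Finset.univ.filter (fun i : Fin d => i.1 < m),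
      lyapunov m (x + (1 : ℤ) • unitVec d i) + lyapunov m (x + (-1 : ℤ) • unitVec d i)
        - 2 * lyapunov m x ≤
      lyapunov m x / a ^ 2 * (3 / 8 - a / 2 + 3 / 2 * (x i : ℝ) ^ 2) := by
    intro i hi
    have hi' : i.1 < m := by simpa using hi
    have h1 := lyapunov_step_le x hi' (Or.inl rfl)
    have h2 := lyapunov_step_le x hi' (Or.inr rfl)
    rw [← ha] at h1 h2
    refine (sub_le_sub_right (add_le_add h1 h2) _).trans_eq ?_
    push_cast
    field_simp
    ring
  refine (Finset.sum_le_sum hbound).trans ?_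
  rw [← Finset.mul_sum, Finset.sum_add_distrib, ← Finset.mul_sum, Finset.sum_const,
    card_filter_val_lt hmd, nsmul_eq_mul]
  have hV : ∑ i ∈ Finset.univ.filter (fun i : Fin d => i.1 < m), (x i : ℝ) ^ 2
      = firstNormSq m x := by
    rw [firstNormSq]
    push_cast
    rfl
  rw [hV]
  refine mul_nonpos_of_nonneg_of_nonpos (div_nonneg (lyapunov_pos m x).le (sq_nonneg _)) ?_
  have hm' : (3 : ℝ) ≤ m := by exact_mod_cast hm
  nlinarith

lemma stepMean_lyapunov_le {d d₁ d₂ : ℕ} (hd₁ : 1 ≤ d₁) (hd₁' : d₁ ≤ d) (hd₂ : 1 ≤ d₂)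
    (hd₂' : d₂ ≤ d) (hover : d < d₁ + d₂) (h3 : 3 ≤ d - d₂) (h : ℕ → Fin d → ℤ) (n : ℕ) :
    stepMean d d₁ d₂ (fun _ y => lyapunov (d - d₂) y) h n ≤ lyapunov (d - d₂) (h n) := by
  have hpos := card_stepDirs_pos hd₁ hd₁' hd₂ hd₂' h n
  rw [stepMean, div_le_iff₀ (by rw [card_signedDirs]; exact_mod_cast (by omega)), card_signedDirs,
    signedDirs, Finset.sum_product]
  simp only [Finset.sum_pair (show (1 : ℤ) ≠ -1 by norm_num)]
  rw [← sub_nonpos]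
  push_cast
  have hterm : ∀ i : Fin d, ¬ i.1 < d - d₂ →
      lyapunov (d - d₂) (h n + (1 : ℤ) • unitVec d i)
        + lyapunov (d - d₂) (h n + (-1 : ℤ) • unitVec d i) - 2 * lyapunov (d - d₂) (h n) = 0 := by
    intro i hi
    simp only [lyapunov, firstNormSq_add_of_not_lt _ hi]
    ring
  have hrw : ∑ i ∈ stepDirs d d₁ d₂ h n, (lyapunov (d - d₂) (h n + (1 : ℤ) • unitVec d i)
        + lyapunov (d - d₂) (h n + (-1 : ℤ) • unitVec d i)) -
        lyapunov (d - d₂) (h n) * ((stepDirs d d₁ d₂ h n).card * 2) =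
      ∑ i ∈ stepDirs d d₁ d₂ h n, (lyapunov (d - d₂) (h n + (1 : ℤ) • unitVec d i)
        + lyapunov (d - d₂) (h n + (-1 : ℤ) • unitVec d i) - 2 * lyapunov (d - d₂) (h n)) := by
    rw [Finset.sum_sub_distrib, Finset.sum_const, nsmul_eq_mul]
    ring
  rw [hrw]
  by_cases H : ∀ k < n, h n ≠ h k
  · rw [stepDirs_of_new H]
    refine le_of_eq_of_le (Finset.sum_subset (fun i hi => ?_) fun i _ hi => ?_).symm
      (sum_lyapunov_sub_nonpos h3 (Nat.sub_le d d₂) (h n))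
    · simp only [Finset.mem_filter, Finset.mem_univ, true_and] at hi ⊢
      omega
    · exact hterm i (by simpa using hi)
  · rw [stepDirs_of_old H]
    refine (Finset.sum_eq_zero fun i hi => hterm i ?_).le
    simpa using hi

/-- A single step in one of the first `m` coordinates changes the parity of `firstNormSq m`. -/
lemma firstNormSq_ne_of_step {d m : ℕ} {x y : Fin d → ℤ} {i : Fin d} {ε : ℤ}
    (hε : ε = 1 ∨ ε = -1) (hy : y = x + ε • unitVec d i)
    (hmove : ∃ j : Fin d, j.1 < m ∧ y j ≠ x j) : firstNormSq m y ≠ firstNormSq m x := by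
  obtain ⟨j, hj, hne⟩ := hmove
  have hij : j = i := by
    by_contra hji
    exact hne (by simp [hy, unitVec, hji])
  rw [hy, firstNormSq_add_of_lt x (hij ▸ hj) hε]
  rcases hε with rfl | rfl <;> omega

lemma IsBERW.supermartingale_lyapunov {d d₁ d₂ : ℕ} {Ω : Type*} [MeasurableSpace Ω]
    {P : Measure Ω} [IsProbabilityMeasure P] {S : ℕ → Ω → Fin d → ℤ}
    (hS : IsBERW d d₁ d₂ P S) (hd₁ : 1 ≤ d₁) (hd₁' : d₁ ≤ d) (hd₂ : 1 ≤ d₂) (hd₂' : d₂ ≤ d)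
    (hover : d < d₁ + d₂) (h3 : 3 ≤ d - d₂) :
    Supermartingale (fun n ω => lyapunov (d - d₂) (S n ω)) hS.filtration P := by
  have hmeas : ∀ n, StronglyMeasurable[hS.filtration n]
      (fun ω => lyapunov (d - d₂) (S n ω)) := fun n =>
    hS.stronglyMeasurable_of_history n (fun h => lyapunov (d - d₂) (h n)) fun h h' H => by
      simp only [H n le_rfl]
  have hbd : ∀ x : Fin d → ℤ, |lyapunov (d - d₂) x| ≤ 1 := fun x => by
    rw [abs_of_pos (lyapunov_pos _ x)]
    exact lyapunov_le_one _ x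
  refine supermartingale_nat hmeas (fun n => Integrable.of_bound
    ((hmeas n).mono (hS.filtration.le n)).aestronglyMeasurable 1
      (ae_of_all _ fun ω => hbd _)) fun n => ?_
  filter_upwards [hS.condExp_pair hd₁ hd₁' hd₂ hd₂' (g := fun _ y => lyapunov (d - d₂) y)
    zero_le_one (fun x i ε _ => hbd _) n] with ω hω
  rw [← hω]
  exact stepMean_lyapunov_le hd₁ hd₁' hd₂ hd₂' hover h3 _ n

lemma IsBERW.isTransientWalk {d d₁ d₂ : ℕ} {Ω : Type*} [MeasurableSpace Ω]
    {P : Measure Ω} [IsProbabilityMeasure P] {S : ℕ → Ω → Fin d → ℤ}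
    (hS : IsBERW d d₁ d₂ P S) (hd₁ : 1 ≤ d₁) (hd₁' : d₁ ≤ d) (hd₂ : 1 ≤ d₂)
    (hover : d < d₁ + d₂) (h3 : 3 ≤ d - d₂) : IsTransientWalk d P S := by
  have hd₂' : d₂ < d := by omega
  have hsuper := hS.supermartingale_lyapunov hd₁ hd₁' hd₂ hd₂'.le hover h3
  have hnorm : ∀ n, eLpNorm ((-fun n ω => lyapunov (d - d₂) (S n ω)) n) 1 P ≤ (1 : NNReal) := by
    intro n
    refine (eLpNorm_le_of_ae_bound (C := 1) (ae_of_all _ fun ω => ?_)).trans ?_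
    · simp only [Pi.neg_apply, norm_neg, Real.norm_eq_abs]
      rw [abs_of_pos (lyapunov_pos _ _)]
      exact lyapunov_le_one _ _
    · simp
  filter_upwards [hsuper.neg.exists_ae_tendsto_of_bdd hnorm,
    hS.ae_frequently_move hd₁ hd₁' hd₂ hd₂' hover,
    hS.ae_step hd₁ hd₁' hd₂ hd₂'.le] with ω hconv hmove hstep x
  obtain ⟨c, hc⟩ := hconv
  have hc' : Tendsto (fun n => lyapunov (d - d₂) (S n ω)) atTop (𝓝 (-c)) := by
    simpa using hc.neg
  by_contra hinf
  have hfreq := Nat.frequently_atTop_iff_infinite.2 hinf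
  have hcx : -c = lyapunov (d - d₂) x := by
    by_contra hne
    refine hfreq ?_
    filter_upwards [hc'.eventually_ne hne] with n hn hx
    exact hn (by rw [show S n ω = x from hx])
  rw [hcx] at hc'
  have hV := ((hc'.inv₀ (lyapunov_pos _ x).ne').pow 4).sub_const 110
  simp only [lyapunov_inv_pow, add_sub_cancel_left] at hV
  refine hmove ?_
  filter_upwards [eventually_succ_eq_of_tendsto hV] with n hn hex
  obtain ⟨p, hp, h2⟩ := hstep n
  simp only [signedDirs, Finset.mem_product, Finset.mem_insert, Finset.mem_singleton] at hp
  exact firstNormSq_ne_of_step hp.2 h2 hex hn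

end BalancedExcitedWalk

/-- If `d₁ − r ≥ 3` (where `r = d₁ + d₂ − d`), then the number of times up to time
`n` at which the walk moves in one of the first `d₁ − r = d − d₂` coordinates
(`0`-indexed: coordinates `i` with `i < d - d₂`) tends to infinity almost surely,
and the walk is transient. -/
theorem berw_transient_of_first_coords {Ω : Type*} [MeasurableSpace Ω]
    (P : Measure Ω) [IsProbabilityMeasure P] (d d₁ d₂ r : ℕ)
    (hd : 2 ≤ d) (hd₁ : 1 ≤ d₁) (hd₁' : d₁ ≤ d) (hd₂ : 1 ≤ d₂) (hd₂' : d₂ ≤ d)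
    (hover : d < d₁ + d₂) (hr : r = d₁ + d₂ - d) (h3 : 3 ≤ d₁ - r)
    (S : ℕ → Ω → Fin d → ℤ) (hS : IsBERW d d₁ d₂ P S) :
    (∀ᵐ ω ∂P, Tendsto (fun n : ℕ =>
        ((Finset.range n).filter
          (fun k => ∃ i : Fin d, i.1 < d - d₂ ∧ S (k + 1) ω i ≠ S k ω i)).card)
      atTop atTop) ∧
    IsTransientWalk d P S := by
  have hr' : d₁ - r = d - d₂ := by omega
  rw [hr'] at h3
  refine ⟨?_, hS.isTransientWalk hd₁ hd₁' hd₂ hover h3⟩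
  filter_upwards [hS.ae_frequently_move hd₁ hd₁' hd₂ (by omega) hover] with ω hω
  exact tendsto_card_filter_range_atTop hω
end

section
/- Let d ≥ 7 and let 1 ≤ d₁, d₂ ≤ d with d₁ + d₂ > d. Then at least one of the following three inequalities holds, where r := d₁ + d₂ − d: r ≥ 3, or d₁ − r ≥ 3, or d₂ − r ≥ 3. Consequently the M_d(d₁,d₂) balanced excited random walk is transient for every d ≥ 7 and all admissible d₁, d₂. -/
open MeasureTheory Filter

/-- A fourth-root potential on squared norms; it is superharmonic for simple random walk
on `ℤ³`. -/
noncomputable def potential (q : ℤ) : ℝ := ((q : ℝ) + 110) ^ (-(1 / 4) : ℝ)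

lemma one_add_rpow_neg_quarter_le {t : ℝ} (h1 : -(1 / 10) ≤ t) (h2 : t ≤ 1 / 10) :
    (1 + t) ^ (-(1 / 4) : ℝ) ≤ 1 - t / 4 + 3 * t ^ 2 / 16 := by
  have hP : 0 < 1 - t / 4 + 3 * t ^ 2 / 16 := by nlinarith
  have ht : 0 < 1 + t := by linarith
  have key : 1 ≤ (1 + t) * (1 - t / 4 + 3 * t ^ 2 / 16) ^ 4 := by
    have hsq : 1 - t / 2 + 7 / 16 * t ^ 2 - 3 / 32 * t ^ 3
        ≤ (1 - t / 4 + 3 * t ^ 2 / 16) ^ 2 := by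
      nlinarith [pow_nonneg (sq_nonneg t) 2]
    have ht2 : t ^ 2 ≤ 1 / 100 := by nlinarith
    have ht2' := sq_nonneg t
    have ht3 : -(1 / 1000) ≤ t ^ 3 := by nlinarith
    have ht3' : t ^ 3 ≤ 1 / 1000 := by nlinarith
    have ht4 : t ^ 4 ≤ 1 / 10000 := by nlinarith
    have ht5 : -(1 / 100000) ≤ t ^ 5 := by nlinarith
    have hpos : 0 ≤ 1 - t / 2 + 7 / 16 * t ^ 2 - 3 / 32 * t ^ 3 := by linarith
    have hfour := pow_le_pow_left₀ hpos hsq 2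
    have hexp : (1 + t) * (1 - t / 2 + 7 / 16 * t ^ 2 - 3 / 32 * t ^ 3) ^ 2
        = 1 + t ^ 2 * (1 / 8 + t / 2 - 87 / 256 * t ^ 2 + 52 / 256 * t ^ 3
          - 75 / 1024 * t ^ 4 + 9 / 1024 * t ^ 5) := by ring
    have hrem : 0 ≤ t ^ 2 * (1 / 8 + t / 2 - 87 / 256 * t ^ 2 + 52 / 256 * t ^ 3
          - 75 / 1024 * t ^ 4 + 9 / 1024 * t ^ 5) := mul_nonneg ht2' (by linarith)
    have := mul_le_mul_of_nonneg_left hfour ht.le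
    rw [hexp, ← pow_mul] at this
    linarith
  rw [Real.rpow_neg ht.le, inv_le_iff_one_le_mul₀ (by positivity)]
  have h4 : ((1 + t) ^ ((1 / 4 : ℝ))) ^ 4 = 1 + t := by
    rw [← Real.rpow_natCast, ← Real.rpow_mul ht.le]; norm_num
  have : (1 : ℝ) ^ 4 ≤ ((1 - t / 4 + 3 * t ^ 2 / 16) * (1 + t) ^ ((1 / 4 : ℝ))) ^ 4 := by
    rw [mul_pow, h4]; linarith
  exact le_of_pow_le_pow_left₀ (by norm_num) (by positivity) this

lemma potential_add_le {q a : ℤ} (hq : 0 ≤ q) (h : |10 * (a : ℝ)| ≤ q + 110) :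
    potential (q + a) ≤ potential q *
      (1 - a / ((q : ℝ) + 110) / 4 + 3 * (a / ((q : ℝ) + 110)) ^ 2 / 16) := by
  have hq' : (0 : ℝ) ≤ q := by exact_mod_cast hq
  have hu : (0 : ℝ) < q + 110 := by linarith
  obtain ⟨h1, h2⟩ := abs_le.1 h
  have hl : -(1 / 10) ≤ a / ((q : ℝ) + 110) := by rw [le_div_iff₀ hu]; linarith
  have hr : a / ((q : ℝ) + 110) ≤ 1 / 10 := by rw [div_le_iff₀ hu]; linarith
  have hsplit : ((q + a : ℤ) : ℝ) + 110 = (q + 110) * (1 + a / ((q : ℝ) + 110)) := by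
    push_cast; field_simp; ring
  unfold potential
  rw [hsplit, Real.mul_rpow hu.le (by linarith)]
  exact mul_le_mul_of_nonneg_left (one_add_rpow_neg_quarter_le hl hr)
    (Real.rpow_nonneg hu.le _)

lemma potential_superharmonic (x : Fin 3 → ℤ) :
    ∑ p : Fin 3 × ℤˣ, (potential (∑ k, x k ^ 2 + (1 + 2 * (p.2 : ℤ) * x p.1))
      - potential (∑ k, x k ^ 2)) ≤ 0 := by
  set q : ℤ := ∑ k, x k ^ 2 with hqdef
  have hq : 0 ≤ q := Finset.sum_nonneg fun k _ => sq_nonneg _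
  have hq' : (0 : ℝ) ≤ q := by exact_mod_cast hq
  have hu : (0 : ℝ) < q + 110 := by linarith
  have hbound (p : Fin 3 × ℤˣ) :
      |10 * ((1 + 2 * (p.2 : ℤ) * x p.1 : ℤ) : ℝ)| ≤ q + 110 := by
    have hk : x p.1 ^ 2 ≤ q :=
      Finset.single_le_sum (f := fun k => x k ^ 2) (fun k _ => sq_nonneg _) (Finset.mem_univ p.1)
    have : |10 * (1 + 2 * (p.2 : ℤ) * x p.1)| ≤ q + 110 := by
      rcases Int.units_eq_one_or p.2 with h | h <;> rw [h, abs_le] <;> push_cast <;>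
        constructor <;> nlinarith [sq_nonneg (x p.1 - 10), sq_nonneg (x p.1 + 10)]
    exact_mod_cast this
  have hpot : 0 ≤ potential q := Real.rpow_nonneg hu.le _
  calc _ ≤ ∑ p : Fin 3 × ℤˣ, potential q *
        (-(((1 + 2 * (p.2 : ℤ) * x p.1 : ℤ) : ℝ) / ((q : ℝ) + 110) / 4)
          + 3 * (((1 + 2 * (p.2 : ℤ) * x p.1 : ℤ) : ℝ) / ((q : ℝ) + 110)) ^ 2 / 16) := by
        refine Finset.sum_le_sum fun p _ => ?_
        have := potential_add_le hq (hbound p)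
        linarith
    _ = potential q * ((-6 / (4 * ((q : ℝ) + 110))
          + 3 * (6 + 8 * q) / (16 * ((q : ℝ) + 110) ^ 2))) := by
        have hqr : (q : ℝ) = (x 0 : ℝ) ^ 2 + (x 1 : ℝ) ^ 2 + (x 2 : ℝ) ^ 2 := by
          rw [hqdef, Fin.sum_univ_three]; push_cast; ring
        rw [← Finset.mul_sum]
        congr 1
        rw [Fintype.sum_prod_type, Fin.sum_univ_three]
        simp only [UnitsInt.univ]
        rw [Finset.sum_pair (by decide), Finset.sum_pair (by decide),
          Finset.sum_pair (by decide)]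
        generalize hU : (q : ℝ) + 110 = u at *
        rw [hqr]
        push_cast
        field_simp
        ring
    _ ≤ 0 := by
        apply mul_nonpos_of_nonneg_of_nonpos hpot
        have : (-6 / (4 * ((q : ℝ) + 110)) + 3 * (6 + 8 * q) / (16 * ((q : ℝ) + 110) ^ 2))
            = (18 - 24 * 110) / (16 * ((q : ℝ) + 110) ^ 2) := by
          field_simp; ring
        rw [this]
        exact div_nonpos_of_nonpos_of_nonneg (by norm_num) (by positivity)

lemma potential_lt {a b : ℤ} (ha : -110 < a) (hab : a < b) : potential b < potential a := by
  have h1 : (-110 : ℝ) < a := by exact_mod_cast ha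
  have h2 : (a : ℝ) < b := by exact_mod_cast hab
  exact Real.rpow_lt_rpow_of_neg (by linarith) (by linarith) (by norm_num)

lemma potential_le {a b : ℤ} (ha : -110 < a) (hab : a ≤ b) : potential b ≤ potential a := by
  rcases hab.eq_or_lt with rfl | h
  exacts [le_rfl, (potential_lt ha h).le]

lemma potential_nonneg {a : ℤ} (ha : 0 ≤ a) : 0 ≤ potential a := by
  have h1 : (0 : ℝ) ≤ a := by exact_mod_cast ha
  exact Real.rpow_nonneg (by linarith) _

/-- If the potential converges along a sequence of nonnegative integers that changes value
infinitely often, then each value is attained finitely often. -/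
lemma eventually_ne_of_tendsto_potential {q : ℕ → ℤ} (hq : ∀ n, 0 ≤ q n) {L : ℝ}
    (hL : Tendsto (fun n => potential (q n)) atTop (nhds L))
    (hmove : ∃ᶠ n in atTop, q (n + 1) ≠ q n) (a : ℤ) : ∀ᶠ n in atTop, q n ≠ a := by
  by_contra hcon
  have hfreq : ∃ᶠ n in atTop, q n = a := by
    exact fun h => hcon h
  have ha : 0 ≤ a := by
    obtain ⟨n, hn⟩ := hfreq.exists
    exact hn ▸ hq n
  have hLa : L = potential a := by
    by_contra hne
    exact hfreq ((hL.eventually_ne hne).mono fun n hn hqa => hn (by rw [hqa]))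
  subst hLa
  have h1 := hL.eventually (lt_mem_nhds (potential_lt (by omega) (lt_add_one a)))
  have h2 := hL.eventually (gt_mem_nhds (potential_lt (by omega) (sub_one_lt a)))
  have hconst : ∀ᶠ n in atTop, q n = a := by
    filter_upwards [h1, h2] with n hn1 hn2
    by_contra hne
    rcases lt_or_gt_of_ne hne with h | h
    · exact absurd (potential_le (by have := hq n; omega) (show q n ≤ a - 1 by omega))
        (not_le.2 hn2)
    · exact absurd (potential_le (by omega) (show a + 1 ≤ q n by omega)) (not_le.2 hn1)
  refine hmove ?_
  filter_upwards [hconst, (tendsto_add_atTop_nat 1).eventually hconst] with n hn hn' hne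
  exact hne (hn'.trans hn.symm)

/-- The signed unit vector `ε e_i`. -/
def stepVec {d : ℕ} (p : Fin d × ℤˣ) : Fin d → ℤ := (p.2 : ℤ) • unitVec d p.1

lemma stepVec_apply {d : ℕ} (p : Fin d × ℤˣ) (j : Fin d) :
    stepVec p j = if j = p.1 then (p.2 : ℤ) else 0 := by
  simp [stepVec, unitVec]

lemma stepVec_injective {d : ℕ} : Function.Injective (stepVec (d := d)) := by
  rintro ⟨i, ε⟩ ⟨j, δ⟩ h
  have h1 := congrFun h i
  simp only [stepVec_apply, if_true] at h1
  split_ifs at h1 with hij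
  · subst hij
    simpa [Units.ext_iff] using h1
  · exact absurd h1 ε.ne_zero

/-- The site occupied at time `n` was not visited before. -/
def IsNewSite {Ω : Type*} {d : ℕ} (S : ℕ → Ω → Fin d → ℤ) (n : ℕ) (ω : Ω) : Prop :=
  ∀ k < n, S n ω ≠ S k ω

/-- The directions available at a new site (if `b`) or at an old site (if `¬ b`). -/
def Allowed (d d₁ d₂ : ℕ) (b : Prop) (i : Fin d) : Prop :=
  (b ∧ i.1 < d₁) ∨ (¬ b ∧ d - d₂ ≤ i.1)

open Classical in
/-- The jump probability in directions `± e_i` at a new or an old site. -/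
noncomputable def jumpProb (d d₁ d₂ : ℕ) (b : Prop) (i : Fin d) : ℝ :=
  if Allowed d d₁ d₂ b i then (2 * if b then (d₁ : ℝ) else d₂)⁻¹ else 0

lemma jumpProb_nonneg {d d₁ d₂ : ℕ} (b : Prop) (i : Fin d) : 0 ≤ jumpProb d d₁ d₂ b i := by
  unfold jumpProb; positivity

lemma jumpProb_le_one {d d₁ d₂ : ℕ} (hd₁ : 1 ≤ d₁) (hd₂ : 1 ≤ d₂) (b : Prop) (i : Fin d) :
    jumpProb d d₁ d₂ b i ≤ 1 := by
  have h1 : (1 : ℝ) ≤ d₁ := by exact_mod_cast hd₁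
  have h2 : (1 : ℝ) ≤ d₂ := by exact_mod_cast hd₂
  unfold jumpProb
  split_ifs
  · exact inv_le_one_of_one_le₀ (by linarith)
  · exact inv_le_one_of_one_le₀ (by linarith)
  · exact zero_le_one

lemma le_jumpProb {d d₁ d₂ : ℕ} (hd₁ : 1 ≤ d₁) (hd₁' : d₁ ≤ d) (hd₂ : 1 ≤ d₂) (hd₂' : d₂ ≤ d)
    {b : Prop} {i : Fin d} (h : Allowed d d₁ d₂ b i) :
    (2 * (d : ℝ))⁻¹ ≤ jumpProb d d₁ d₂ b i := by
  have h1 : (1 : ℝ) ≤ d₁ := by exact_mod_cast hd₁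
  have h2 : (1 : ℝ) ≤ d₂ := by exact_mod_cast hd₂
  have h1' : (d₁ : ℝ) ≤ d := by exact_mod_cast hd₁'
  have h2' : (d₂ : ℝ) ≤ d := by exact_mod_cast hd₂'
  unfold jumpProb
  rw [if_pos h]
  split_ifs
  · exact inv_anti₀ (by linarith) (by linarith)
  · exact inv_anti₀ (by linarith) (by linarith)

section Uniform

variable {Ω V ι : Type*} [MeasurableSpace Ω] [MeasurableSpace V] [MeasurableSingletonClass V]

/-- A variable that is uniform on finitely many values, given an event, takes no other values. -/
lemma measure_inter_notMem_image_eq_zero (P : Measure Ω) [IsFiniteMeasure P] {A : Set Ω}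
    {X : Ω → V} (hX : Measurable X) (I : Finset ι) (hI : I.Nonempty)
    {v : ι → V} (hv : Function.Injective v)
    (h : ∀ p ∈ I, P (A ∩ X ⁻¹' {v p}) = P A / (I.card : ENNReal)) :
    P (A \ X ⁻¹' (v '' I)) = 0 := by
  have hmeas : MeasurableSet (X ⁻¹' (v '' I)) :=
    hX (I.finite_toSet.image v).measurableSet
  have hunion : A ∩ X ⁻¹' (v '' I) = ⋃ p ∈ I, X ⁻¹' {v p} ∩ A := by
    ext ω; simp only [Set.mem_inter_iff, Set.mem_preimage, Set.mem_image, Set.mem_iUnion,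
      Set.mem_singleton_iff, Finset.mem_coe]
    constructor
    · rintro ⟨hA, p, hp, he⟩; exact ⟨p, hp, he.symm, hA⟩
    · rintro ⟨p, hp, he, hA⟩; exact ⟨hA, p, hp, he.symm⟩
  have hfull : P (A ∩ X ⁻¹' (v '' I)) = P A := by
    have hsum := measure_biUnion_finset (μ := P.restrict A) (s := I)
      (f := fun p => X ⁻¹' {v p})
      (fun p _ q _ hpq => (Disjoint.preimage X (by simpa using fun h => hpq (hv h))))
      (fun p _ => hX (measurableSet_singleton _))
    have hres (B : Set V) (hB : MeasurableSet B) :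
        (P.restrict A) (X ⁻¹' B) = P (A ∩ X ⁻¹' B) := by
      rw [Measure.restrict_apply (hX hB), Set.inter_comm]
    have hset : X ⁻¹' (v '' I) = ⋃ p ∈ I, X ⁻¹' {v p} := by
      ext ω; simp [eq_comm]
    rw [← hres _ (I.finite_toSet.image v).measurableSet, hset, hsum,
      Finset.sum_congr rfl (fun p hp => (hres _ (measurableSet_singleton _)).trans (h p hp)),
      Finset.sum_const, nsmul_eq_mul]
    exact ENNReal.mul_div_cancel (by simpa using hI.ne_empty) (by simp)
  have := measure_inter_add_sdiff (μ := P) A hmeas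
  rw [hfull] at this
  exact (ENNReal.add_right_inj (measure_ne_top P A)).1 (this.trans (add_zero _).symm)

end Uniform

section Walk

variable {Ω : Type*} {d d₁ d₂ : ℕ}

/-- The trajectory up to time `n`. -/
def hist (S : ℕ → Ω → Fin d → ℤ) (n : ℕ) (ω : Ω) : Fin (n + 1) → Fin d → ℤ := fun k => S k ω

lemma setOf_hist_eq (S : ℕ → Ω → Fin d → ℤ) (n : ℕ) (ω₀ : Ω) :
    hist S n ⁻¹' {hist S n ω₀} = {ω | ∀ k ≤ n, S k ω = S k ω₀} := by
  ext ω
  simp only [hist, Set.mem_preimage, Set.mem_singleton_iff, funext_iff, Set.mem_ofPred_eq]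
  constructor
  · intro h k hk j
    exact h ⟨k, by omega⟩ j
  · intro h k j
    exact h k (by omega) j

lemma isNewSite_congr {S : ℕ → Ω → Fin d → ℤ} {n : ℕ} {ω ω₀ : Ω} (h : hist S n ω = hist S n ω₀) :
    IsNewSite S n ω ↔ IsNewSite S n ω₀ := by
  have hk (k : ℕ) (hk : k ≤ n) : S k ω = S k ω₀ := congrFun h ⟨k, by omega⟩
  unfold IsNewSite
  exact forall₂_congr fun k hkn => by rw [hk k hkn.le, hk n le_rfl]

variable [MeasurableSpace Ω]

lemma measurable_hist {S : ℕ → Ω → Fin d → ℤ} (hS : ∀ n, Measurable (S n)) (n : ℕ) :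
    Measurable (hist S n) :=
  measurable_pi_lambda _ fun k => hS k

/-- The filtration generated by the trajectory. -/
def histFiltration (S : ℕ → Ω → Fin d → ℤ) (hS : ∀ n, Measurable (S n)) :
    Filtration ℕ (inferInstance : MeasurableSpace Ω) where
  seq n := MeasurableSpace.comap (hist S n) inferInstance
  mono' := by
    intro m n hmn
    have : hist S m = (fun a (k : Fin (m + 1)) => a (Fin.castLE (by omega) k)) ∘ hist S n := rfl
    simp only
    rw [this, ← MeasurableSpace.comap_comp]
    exact MeasurableSpace.comap_mono (Measurable.comap_le (by fun_prop))
  le' n := (measurable_hist hS n).comap_le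

lemma measurable_histFiltration {S : ℕ → Ω → Fin d → ℤ} (hS : ∀ n, Measurable (S n))
    {k n : ℕ} (hk : k ≤ n) : Measurable[histFiltration S hS n] (S k) := by
  have h : Measurable (fun a : Fin (n + 1) → Fin d → ℤ => a ⟨k, by omega⟩) := by fun_prop
  exact h.comp (comap_measurable (hist S n))

lemma measurableSet_isNewSite {S : ℕ → Ω → Fin d → ℤ} (hS : ∀ n, Measurable (S n)) (n : ℕ) :
    MeasurableSet[histFiltration S hS n] {ω | IsNewSite S n ω} := by
  have : {ω | IsNewSite S n ω} = ⋂ k, ⋂ (_ : k < n), {ω | S n ω = S k ω}ᶜ := by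
    ext; simp [IsNewSite]
  rw [this]
  refine MeasurableSet.iInter fun k => MeasurableSet.iInter fun hk => MeasurableSet.compl ?_
  exact measurableSet_eq_fun (measurable_histFiltration hS le_rfl)
    (measurable_histFiltration hS hk.le)

/-- The event that the `n`-th jump is `p`. -/
def jumpSet (S : ℕ → Ω → Fin d → ℤ) (n : ℕ) (p : Fin d × ℤˣ) : Set Ω :=
  {ω | S (n + 1) ω = S n ω + stepVec p}

lemma measurableSet_jumpSet {S : ℕ → Ω → Fin d → ℤ} (hS : ∀ n, Measurable (S n)) (n : ℕ)
    (p : Fin d × ℤˣ) : MeasurableSet[histFiltration S hS (n + 1)] (jumpSet S n p) :=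
  measurableSet_eq_fun (measurable_histFiltration hS le_rfl)
    ((measurable_of_countable fun x : Fin d → ℤ => x + stepVec p).comp
      (measurable_histFiltration hS n.le_succ))

open Classical in
lemma card_filter_allowed (hd₁' : d₁ ≤ d) (hd₂' : d₂ ≤ d) (b : Prop) :
    (Finset.univ.filter (fun p : Fin d × ℤˣ => Allowed d d₁ d₂ b p.1)).card
      = 2 * if b then d₁ else d₂ := by
  have : (Finset.univ.filter (fun p : Fin d × ℤˣ => Allowed d d₁ d₂ b p.1))
      = (Finset.univ.filter (fun i : Fin d => Allowed d d₁ d₂ b i)) ×ˢ Finset.univ := by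
    ext; simp only [Finset.mem_filter, Finset.mem_univ, true_and, Finset.mem_product, and_true]
  rw [this, Finset.card_product, Finset.card_univ, Fintype.card_units_int, mul_comm]
  congr 1
  split_ifs with hb
  · simp only [Allowed, hb, true_and, not_true, false_and, or_false]
    rw [Fin.card_filter_val_lt]; omega
  · simp only [Allowed, hb, false_and, not_false_iff, true_and, false_or]
    have h := Finset.card_filter_add_card_filter_not (s := Finset.univ (α := Fin d))
      (fun i => i.1 < d - d₂)
    simp only [not_lt, Finset.card_univ, Fintype.card_fin] at h
    rw [Fin.card_filter_val_lt] at h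
    omega

variable {P : Measure Ω} {S : ℕ → Ω → Fin d → ℤ}

lemma IsBERW.measure_atom_inter (hS : IsBERW d d₁ d₂ P S) (n : ℕ) (ω₀ : Ω) {p : Fin d × ℤˣ}
    (hp : Allowed d d₁ d₂ (IsNewSite S n ω₀) p.1) :
    P (hist S n ⁻¹' {hist S n ω₀} ∩ jumpSet S n p)
      = P (hist S n ⁻¹' {hist S n ω₀}) * ENNReal.ofReal (jumpProb d d₁ d₂ (IsNewSite S n ω₀) p.1)
      := by
  have hε : (p.2 : ℤ) = 1 ∨ (p.2 : ℤ) = -1 := by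
    rcases Int.units_eq_one_or p.2 with h | h <;> simp [h]
  have hset : hist S n ⁻¹' {hist S n ω₀} ∩ jumpSet S n p = {ω | (∀ k ≤ n, S k ω = S k ω₀) ∧
      S (n + 1) ω = S n ω₀ + (p.2 : ℤ) • unitVec d p.1} := by
    rw [setOf_hist_eq]
    ext ω
    simp only [Set.mem_inter_iff, Set.mem_ofPred_eq, jumpSet, stepVec]
    refine and_congr_right fun h => ?_
    rw [h n le_rfl]
  rw [hset, setOf_hist_eq, jumpProb, if_pos hp]
  have hof {m : ℕ} (hm : 0 < m) : ENNReal.ofReal (2 * (m : ℝ))⁻¹ = (2 * (m : ENNReal))⁻¹ := by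
    rw [ENNReal.ofReal_inv_of_pos (by positivity), ENNReal.ofReal_mul (by norm_num)]
    simp
  rcases hp with ⟨hb, hi⟩ | ⟨hb, hi⟩
  · rw [if_pos hb, hof (by omega), ← div_eq_mul_inv]
    exact hS.2.2.1 n (fun k => S k ω₀) hb p.1 hi p.2 hε
  · rw [if_neg hb]
    have hd₂ : 0 < d₂ := by have := p.1.2; omega
    rw [hof hd₂, ← div_eq_mul_inv]
    refine hS.2.2.2 n (fun k => S k ω₀) ?_ p.1 hi p.2 hε
    simpa [IsNewSite] using hb

lemma ae_of_forall_atom {n : ℕ} {Q : Ω → Prop}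
    (h : ∀ ω₀, P (hist S n ⁻¹' {hist S n ω₀} ∩ {ω | ¬ Q ω}) = 0) : ∀ᵐ ω ∂P, Q ω := by
  rw [ae_iff]
  have hsub : {ω | ¬ Q ω} ⊆ ⋃ a ∈ Set.range (hist S n), hist S n ⁻¹' {a} ∩ {ω | ¬ Q ω} := by
    intro ω hω
    simp only [Set.mem_iUnion]
    exact ⟨hist S n ω, ⟨ω, rfl⟩, rfl, hω⟩
  refine measure_mono_null hsub ((measure_biUnion_null_iff (Set.to_countable _)).2 ?_)
  rintro _ ⟨ω₀, rfl⟩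
  exact h ω₀

variable [IsProbabilityMeasure P]

/-- Almost surely every jump is an allowed one. -/
lemma IsBERW.ae_exists_jump (hS : IsBERW d d₁ d₂ P S) (hd₁ : 1 ≤ d₁) (hd₁' : d₁ ≤ d)
    (hd₂ : 1 ≤ d₂) (hd₂' : d₂ ≤ d) (n : ℕ) :
    ∀ᵐ ω ∂P, ∃ p : Fin d × ℤˣ, Allowed d d₁ d₂ (IsNewSite S n ω) p.1 ∧ ω ∈ jumpSet S n p := by
  classical
  refine ae_of_forall_atom (S := S) (n := n) fun ω₀ => ?_
  set I := Finset.univ.filter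
    (fun p : Fin d × ℤˣ => Allowed d d₁ d₂ (IsNewSite S n ω₀) p.1) with hIdef
  have hcard := card_filter_allowed hd₁' hd₂' (IsNewSite S n ω₀)
  have hcpos : 0 < 2 * if IsNewSite S n ω₀ then d₁ else d₂ := by split_ifs <;> omega
  have hX : Measurable (fun ω => S (n + 1) ω - S n ω) := (hS.1 (n + 1)).sub (hS.1 n)
  have hjump (p : Fin d × ℤˣ) :
      (fun ω => S (n + 1) ω - S n ω) ⁻¹' {stepVec p} = jumpSet S n p := by
    ext ω; simp [jumpSet, sub_eq_iff_eq_add']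
  have := measure_inter_notMem_image_eq_zero P (A := hist S n ⁻¹' {hist S n ω₀}) hX I
    (Finset.card_pos.1 (by rw [hcard]; exact hcpos)) stepVec_injective (by
      intro p hp
      have hp' : Allowed d d₁ d₂ (IsNewSite S n ω₀) p.1 := by simpa [I] using hp
      rw [hjump, hS.measure_atom_inter n ω₀ hp', div_eq_mul_inv, hcard, jumpProb, if_pos hp',
        ENNReal.ofReal_inv_of_pos (by exact_mod_cast hcpos)]
      congr 2
      split_ifs <;> simp [ENNReal.ofReal_mul])
  refine measure_mono_null ?_ this
  rintro ω ⟨hω, hn⟩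
  refine ⟨hω, fun ⟨p, hp, he⟩ => hn ⟨p, ?_, ?_⟩⟩
  · rw [isNewSite_congr hω]
    simpa [I] using hp
  · exact (hjump p) ▸ he.symm

lemma IsBERW.measure_atom_inter_jumpSet (hS : IsBERW d d₁ d₂ P S) (hd₁ : 1 ≤ d₁)
    (hd₁' : d₁ ≤ d) (hd₂ : 1 ≤ d₂) (hd₂' : d₂ ≤ d) (n : ℕ) (ω₀ : Ω) (p : Fin d × ℤˣ) :
    P (hist S n ⁻¹' {hist S n ω₀} ∩ jumpSet S n p)
      = P (hist S n ⁻¹' {hist S n ω₀}) * ENNReal.ofReal (jumpProb d d₁ d₂ (IsNewSite S n ω₀) p.1)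
      := by
  by_cases hp : Allowed d d₁ d₂ (IsNewSite S n ω₀) p.1
  · exact hS.measure_atom_inter n ω₀ hp
  · rw [jumpProb, if_neg hp, ENNReal.ofReal_zero, mul_zero]
    refine measure_mono_null ?_ (ae_iff.1 (hS.ae_exists_jump hd₁ hd₁' hd₂ hd₂' n))
    rintro ω ⟨hω, hj⟩ ⟨p', hp', hj'⟩
    have : p' = p := stepVec_injective (add_left_cancel ((hj'.symm.trans hj)))
    rw [this, isNewSite_congr hω] at hp'
    exact hp hp'

lemma measurable_jumpProb_isNewSite (hS : ∀ n, Measurable (S n)) (n : ℕ) (i : Fin d) :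
    Measurable[histFiltration S hS n] (fun ω => jumpProb d d₁ d₂ (IsNewSite S n ω) i) := by
  classical
  have : (fun ω => jumpProb d d₁ d₂ (IsNewSite S n ω) i) = fun ω =>
      if ω ∈ {ω | IsNewSite S n ω} then jumpProb d d₁ d₂ True i
        else jumpProb d d₁ d₂ False i := by
    ext ω
    by_cases h : IsNewSite S n ω <;> simp [h]
  rw [this]
  exact Measurable.ite (measurableSet_isNewSite hS n) measurable_const measurable_const

/-- The conditional probability, given the past, that the `n`-th jump is `p`. -/
lemma IsBERW.condExp_jumpSet (hS : IsBERW d d₁ d₂ P S) (hd₁ : 1 ≤ d₁)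
    (hd₁' : d₁ ≤ d) (hd₂ : 1 ≤ d₂) (hd₂' : d₂ ≤ d) (n : ℕ) (p : Fin d × ℤˣ) :
    P[(jumpSet S n p).indicator (1 : Ω → ℝ) | histFiltration S hS.1 n]
      =ᵐ[P] fun ω => jumpProb d d₁ d₂ (IsNewSite S n ω) p.1 := by
  have hle := (histFiltration S hS.1).le n
  have hJ : MeasurableSet (jumpSet S n p) :=
    (histFiltration S hS.1).le _ _ (measurableSet_jumpSet hS.1 n p)
  have hm := measurable_jumpProb_isNewSite (d₁ := d₁) (d₂ := d₂) hS.1 n p.1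
  have hm' : Measurable (fun ω => jumpProb d d₁ d₂ (IsNewSite S n ω) p.1) := hm.mono hle le_rfl
  have hint : Integrable (fun ω => jumpProb d d₁ d₂ (IsNewSite S n ω) p.1) P :=
    Integrable.of_bound hm'.aestronglyMeasurable 1 (ae_of_all _ fun ω => by
      rw [Real.norm_of_nonneg (jumpProb_nonneg _ _)]; exact jumpProb_le_one hd₁ hd₂ _ _)
  have hH := measurable_hist hS.1 n
  have hmeas : (P.withDensity fun ω => ENNReal.ofReal
      (jumpProb d d₁ d₂ (IsNewSite S n ω) p.1)).map (hist S n)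
      = (P.restrict (jumpSet S n p)).map (hist S n) := by
    refine Measure.ext_of_singleton fun a => ?_
    rw [Measure.map_apply hH (measurableSet_singleton a),
      Measure.map_apply hH (measurableSet_singleton a),
      Measure.restrict_apply (hH (measurableSet_singleton a)),
      withDensity_apply _ (hH (measurableSet_singleton a))]
    by_cases ha : a ∈ Set.range (hist S n)
    · obtain ⟨ω₀, rfl⟩ := ha
      rw [hS.measure_atom_inter_jumpSet hd₁ hd₁' hd₂ hd₂' n ω₀ p,
        setLIntegral_congr_fun (g := fun _ => ENNReal.ofReal
          (jumpProb d d₁ d₂ (IsNewSite S n ω₀) p.1)) (hH (measurableSet_singleton _))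
          (fun ω hω => by simp only [isNewSite_congr (S := S) hω]),
        setLIntegral_const, mul_comm]
    · have : hist S n ⁻¹' {a} = ∅ := by
        ext ω; simp only [Set.mem_preimage, Set.mem_singleton_iff, Set.mem_empty_iff_false,
          iff_false]
        exact fun h => ha ⟨ω, h⟩
      simp [this]
  refine (ae_eq_condExp_of_forall_setIntegral_eq hle ?_ (fun s _ _ => hint.integrableOn) ?_
    hm.stronglyMeasurable.aestronglyMeasurable).symm
  · exact (integrable_const (1 : ℝ)).indicator hJ
  · rintro s ⟨A, hA, rfl⟩ -
    have hAs := hH hA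
    rw [integral_indicator_one hJ, integral_eq_lintegral_of_nonneg_ae
      (ae_of_all _ fun ω => jumpProb_nonneg _ _) hm'.aestronglyMeasurable,
      ← withDensity_apply _ hAs, ← Measure.map_apply hH hA, hmeas, Measure.map_apply hH hA,
      Measure.restrict_apply hAs, measureReal_def, Measure.restrict_apply hJ, Set.inter_comm]

/-- If a jump `p` is allowed on the adapted events `D n`, and infinitely many of these events
occur, then `p` is performed on infinitely many of them. -/
lemma IsBERW.ae_frequently_jump (hS : IsBERW d d₁ d₂ P S) (hd₁ : 1 ≤ d₁)
    (hd₁' : d₁ ≤ d) (hd₂ : 1 ≤ d₂) (hd₂' : d₂ ≤ d) (p : Fin d × ℤˣ) {D : ℕ → Set Ω}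
    (hD : ∀ n, MeasurableSet[histFiltration S hS.1 n] (D n))
    (hallowed : ∀ n, ∀ ω ∈ D n, Allowed d d₁ d₂ (IsNewSite S n ω) p.1) :
    ∀ᵐ ω ∂P, (∃ᶠ n in atTop, ω ∈ D n) → ∃ᶠ n in atTop, ω ∈ D n ∩ jumpSet S n p := by
  let s : ℕ → Set Ω := fun n => Nat.casesOn n ∅ fun n => D n ∩ jumpSet S n p
  have hs (n : ℕ) : MeasurableSet[histFiltration S hS.1 n] (s n) := by
    cases n with
    | zero => exact @MeasurableSet.empty _ (histFiltration S hS.1 0)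
    | succ n =>
      exact MeasurableSet.inter ((histFiltration S hS.1).mono n.le_succ _ (hD n))
        (measurableSet_jumpSet hS.1 n p)
  have hcond (n : ℕ) : P[(s (n + 1)).indicator (1 : Ω → ℝ) | histFiltration S hS.1 n]
      =ᵐ[P] (D n).indicator fun ω => jumpProb d d₁ d₂ (IsNewSite S n ω) p.1 := by
    have hJ : MeasurableSet (jumpSet S n p) :=
      (histFiltration S hS.1).le _ _ (measurableSet_jumpSet hS.1 n p)
    have hind : (s (n + 1)).indicator (1 : Ω → ℝ)
        = (D n).indicator ((jumpSet S n p).indicator 1) := by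
      rw [Set.indicator_indicator]
    rw [hind]
    refine (condExp_indicator ((integrable_const (1 : ℝ)).indicator hJ) (hD n)).trans ?_
    filter_upwards [hS.condExp_jumpSet hd₁ hd₁' hd₂ hd₂' n p] with ω hω
    by_cases h : ω ∈ D n
    · rw [Set.indicator_of_mem h, Set.indicator_of_mem h]
      exact hω
    · rw [Set.indicator_of_notMem h, Set.indicator_of_notMem h]
  have hd : (0 : ℝ) < d := by exact_mod_cast hd₁.trans hd₁'
  filter_upwards [ae_mem_limsup_atTop_iff P hs, ae_all_iff.2 hcond] with ω hlim hc hfreq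
  have hδ : (0 : ℝ) < (2 * (d : ℝ))⁻¹ := by positivity
  have hdiv : Tendsto (fun n => ∑ k ∈ Finset.range n,
      (P[(s (k + 1)).indicator (1 : Ω → ℝ) | histFiltration S hS.1 k]) ω) atTop atTop := by
    simp only [hc]
    refine (not_summable_iff_tendsto_nat_atTop_of_nonneg
      fun n => Set.indicator_nonneg (fun ω _ => jumpProb_nonneg _ _) ω).1 fun hsum => ?_
    have hsmall := hsum.tendsto_atTop_zero.eventually (gt_mem_nhds hδ)
    obtain ⟨n, hn, hn'⟩ := (hfreq.and_eventually hsmall).exists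
    rw [Set.indicator_of_mem hn] at hn'
    exact absurd (le_jumpProb hd₁ hd₁' hd₂ hd₂' (hallowed n ω hn)) (not_le.2 hn')
  have hmem := hlim.2 hdiv
  rw [mem_limsup_iff_frequently_mem, frequently_atTop] at hmem
  refine frequently_atTop.2 fun a => ?_
  obtain ⟨b, hb, hmem⟩ := hmem (a + 1)
  obtain ⟨n, rfl⟩ : ∃ n, b = n + 1 := ⟨b - 1, by omega⟩
  exact ⟨n, by omega, hmem⟩

/-- Almost surely there are infinitely many visits to old sites. -/
lemma IsBERW.ae_frequently_old (hS : IsBERW d d₁ d₂ P S) (hd₁ : 1 ≤ d₁)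
    (hd₁' : d₁ ≤ d) (hd₂ : 1 ≤ d₂) (hd₂' : d₂ ≤ d) {i : Fin d} (hi₁ : i.1 < d₁)
    (hi₂ : d - d₂ ≤ i.1) : ∀ᵐ ω ∂P, ∃ᶠ n in atTop, ¬ IsNewSite S n ω := by
  have hallowed (b : Prop) : Allowed d d₁ d₂ b i := by
    by_cases hb : b
    exacts [Or.inl ⟨hb, hi₁⟩, Or.inr ⟨hb, hi₂⟩]
  have hstep := hS.ae_frequently_jump hd₁ hd₁' hd₂ hd₂' (i, 1) (D := fun _ => Set.univ)
    (fun _ => MeasurableSet.univ) (fun _ _ _ => hallowed _)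
  have hback := hS.ae_frequently_jump hd₁ hd₁' hd₂ hd₂' (i, -1)
    (D := fun n => Nat.casesOn n ∅ fun n => jumpSet S n (i, 1))
    (fun n => by
      cases n with
      | zero => exact @MeasurableSet.empty _ (histFiltration S hS.1 0)
      | succ n => exact measurableSet_jumpSet hS.1 n _)
    (fun _ _ _ => hallowed _)
  filter_upwards [hstep, hback] with ω h1 h2
  have h1 := h1 (Frequently.of_forall fun _ => trivial)
  have h2 := h2 (frequently_atTop.2 fun a => by
    obtain ⟨n, hn, hmem⟩ := frequently_atTop.1 h1 a
    exact ⟨n + 1, by omega, hmem.2⟩)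
  refine frequently_atTop.2 fun a => ?_
  obtain ⟨n, hn, hmem, hmem'⟩ := frequently_atTop.1 h2 a
  cases n with
  | zero => exact absurd hmem (Set.notMem_empty ω)
  | succ n =>
    refine ⟨n + 2, by omega, fun hnew => hnew n (by omega) ?_⟩
    have e1 : S (n + 1) ω = S n ω + stepVec (i, 1) := hmem
    have e2 : S (n + 2) ω = S (n + 1) ω + stepVec (i, -1) := hmem'
    rw [e2, e1]
    simp [stepVec]

/-- Almost surely arbitrarily large displacements occur in a direction that is always allowed. -/
lemma IsBERW.ae_exists_displacement (hS : IsBERW d d₁ d₂ P S) (hd₁ : 1 ≤ d₁)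
    (hd₁' : d₁ ≤ d) (hd₂ : 1 ≤ d₂) (hd₂' : d₂ ≤ d) {i : Fin d} (hi₁ : i.1 < d₁)
    (hi₂ : d - d₂ ≤ i.1) (k : ℕ) :
    ∀ᵐ ω ∂P, ∃ᶠ n in atTop, ∃ m ≤ n, S n ω i = S m ω i + k := by
  induction k with
  | zero => exact ae_of_all _ fun ω => Frequently.of_forall fun n => ⟨n, le_rfl, by simp⟩
  | succ k ih =>
    have hstep := hS.ae_frequently_jump hd₁ hd₁' hd₂ hd₂' (i, 1)
      (D := fun n => {ω | ∃ m ≤ n, S n ω i = S m ω i + k})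
      (fun n => by
        have : {ω | ∃ m ≤ n, S n ω i = S m ω i + k}
            = ⋃ m, ⋃ (_ : m ≤ n), {ω | S n ω i = S m ω i + k} := by
          ext; simp
        rw [this]
        refine MeasurableSet.iUnion fun m => MeasurableSet.iUnion fun hm => ?_
        exact measurableSet_eq_fun
          ((measurable_pi_apply i).comp (measurable_histFiltration hS.1 le_rfl))
          ((measurable_of_countable fun x : Fin d → ℤ => x i + k).comp
            (measurable_histFiltration hS.1 hm)))
      (fun n ω _ => by
        by_cases hb : IsNewSite S n ω
        exacts [Or.inl ⟨hb, hi₁⟩, Or.inr ⟨hb, hi₂⟩])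
    filter_upwards [ih, hstep] with ω h1 h2
    refine frequently_atTop.2 fun a => ?_
    obtain ⟨n, hn, ⟨m, hm, he⟩, hjump⟩ := frequently_atTop.1 (h2 h1) a
    refine ⟨n + 1, by omega, m, by omega, ?_⟩
    have hjump : S (n + 1) ω = S n ω + stepVec (i, 1) := hjump
    rw [hjump, Pi.add_apply, he, stepVec_apply]
    push_cast
    simp [add_assoc]

/-- Almost surely infinitely many sites are visited. -/
lemma IsBERW.ae_frequently_new (hS : IsBERW d d₁ d₂ P S) (hd₁ : 1 ≤ d₁)
    (hd₁' : d₁ ≤ d) (hd₂ : 1 ≤ d₂) (hd₂' : d₂ ≤ d) {i : Fin d} (hi₁ : i.1 < d₁)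
    (hi₂ : d - d₂ ≤ i.1) : ∀ᵐ ω ∂P, ∃ᶠ n in atTop, IsNewSite S n ω := by
  filter_upwards [ae_all_iff.2
    (hS.ae_exists_displacement hd₁ hd₁' hd₂ hd₂' hi₁ hi₂)] with ω hω hcon
  obtain ⟨N, hN⟩ := eventually_atTop.1 hcon
  have hearly (n : ℕ) : ∃ m < N + 1, S n ω = S m ω := by
    induction n using Nat.strong_induction_on with
    | _ n ih =>
      rcases lt_or_ge n (N + 1) with h | h
      · exact ⟨n, h, rfl⟩
      · have hold : ¬ IsNewSite S n ω := hN n (by omega)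
        simp only [IsNewSite, not_forall, not_not] at hold
        obtain ⟨k, hk, he⟩ := hold
        obtain ⟨m, hm, he'⟩ := ih k hk
        exact ⟨m, hm, he.trans he'⟩
  set M := ∑ m ∈ Finset.range (N + 1), (S m ω i).natAbs
  have hM (n : ℕ) : (S n ω i).natAbs ≤ M := by
    obtain ⟨m, hm, he⟩ := hearly n
    rw [he]
    exact Finset.single_le_sum (f := fun m => (S m ω i).natAbs) (fun _ _ => Nat.zero_le _)
      (Finset.mem_range.2 hm)
  obtain ⟨n, m, -, he⟩ := (hω (2 * M + 1)).exists
  have := hM n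
  have := hM m
  omega

/-- The squared norm of the projection onto three coordinates. -/
def sqNorm (J : Fin 3 → Fin d) (y : Fin d → ℤ) : ℤ := ∑ k, y (J k) ^ 2

lemma sqNorm_nonneg (J : Fin 3 → Fin d) (y : Fin d → ℤ) : 0 ≤ sqNorm J y :=
  Finset.sum_nonneg fun _ _ => sq_nonneg _

lemma sqNorm_add_stepVec {J : Fin 3 → Fin d} (hJ : Function.Injective J) (y : Fin d → ℤ)
    (k : Fin 3) (ε : ℤˣ) :
    sqNorm J (y + stepVec (J k, ε)) = sqNorm J y + (1 + 2 * (ε : ℤ) * y (J k)) := by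
  have hε : (ε : ℤ) ^ 2 = 1 := by
    rcases Int.units_eq_one_or ε with h | h <;> simp [h]
  have hterm (l : Fin 3) : (y + stepVec (J k, ε)) (J l) ^ 2
      = y (J l) ^ 2 + if l = k then 1 + 2 * (ε : ℤ) * y (J k) else 0 := by
    rw [Pi.add_apply, stepVec_apply]
    by_cases h : l = k
    · subst h; simp only [if_true]; linear_combination hε
    · simp [h, hJ.eq_iff]
  simp only [sqNorm, hterm, Finset.sum_add_distrib, Finset.sum_ite_eq', Finset.mem_univ, if_true]

lemma sqNorm_add_stepVec_of_notMem {J : Fin 3 → Fin d} (y : Fin d → ℤ) {p : Fin d × ℤˣ}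
    (hp : ∀ k, J k ≠ p.1) : sqNorm J (y + stepVec p) = sqNorm J y := by
  simp [sqNorm, stepVec_apply, hp]

/-- The potential of the projection onto three equally likely coordinates is a
supermartingale. -/
lemma IsBERW.supermartingale_potential (hS : IsBERW d d₁ d₂ P S) (hd₁ : 1 ≤ d₁)
    (hd₁' : d₁ ≤ d) (hd₂ : 1 ≤ d₂) (hd₂' : d₂ ≤ d) {J : Fin 3 → Fin d}
    (hJ : Function.Injective J)
    (hunif : ∀ b k, jumpProb d d₁ d₂ b (J k) = jumpProb d d₁ d₂ b (J 0)) :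
    Supermartingale (fun n ω => potential (sqNorm J (S n ω))) (histFiltration S hS.1) P := by
  have hpot (y : Fin d → ℤ) : |potential (sqNorm J y)| ≤ potential 0 := by
    rw [abs_of_nonneg (potential_nonneg (sqNorm_nonneg J y))]
    exact potential_le (by norm_num) (sqNorm_nonneg J y)
  have hadapted (n : ℕ) (φ : (Fin d → ℤ) → ℝ) :
      StronglyMeasurable[histFiltration S hS.1 n] (fun ω => φ (S n ω)) :=
    ((measurable_of_countable φ).comp (measurable_histFiltration hS.1 le_rfl)).stronglyMeasurable
  refine supermartingale_of_condExp_sub_nonneg_nat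
    (fun n => hadapted n fun y => potential (sqNorm J y))
    (fun n => Integrable.of_bound
      ((measurable_of_countable fun y => potential (sqNorm J y)).comp
        (hS.1 n)).aestronglyMeasurable (potential 0) (ae_of_all _ fun ω => hpot _)) fun n => ?_
  let jump : Fin 3 × ℤˣ → Fin d × ℤˣ := fun p => (J p.1, p.2)
  have hjump : Function.Injective jump := by
    rintro ⟨k, ε⟩ ⟨l, δ⟩ h
    simp only [jump, Prod.mk.injEq] at h
    rw [hJ h.1, h.2]
  let G : Fin 3 × ℤˣ → (Fin d → ℤ) → ℝ := fun p y =>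
    potential (sqNorm J y) - potential (sqNorm J (y + stepVec (jump p)))
  have hint (p : Fin 3 × ℤˣ) :
      Integrable ((jumpSet S n (jump p)).indicator (1 : Ω → ℝ)) P :=
    (integrable_const (1 : ℝ)).indicator
      ((histFiltration S hS.1).le _ _ (measurableSet_jumpSet hS.1 n _))
  have hGbound (p : Fin 3 × ℤˣ) (y : Fin d → ℤ) : ‖G p y‖ ≤ potential 0 + potential 0 :=
    (norm_sub_le _ _).trans (add_le_add (hpot _) (hpot _))
  have hincr : (fun ω => potential (sqNorm J (S n ω))) -
      (fun ω => potential (sqNorm J (S (n + 1) ω)))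
      =ᵐ[P] ∑ p, (fun ω => G p (S n ω)) * (jumpSet S n (jump p)).indicator (1 : Ω → ℝ) := by
    filter_upwards [hS.ae_exists_jump hd₁ hd₁' hd₂ hd₂' n] with ω hω
    obtain ⟨p₀, -, hp₀⟩ := hω
    have hmem (p : Fin d × ℤˣ) : ω ∈ jumpSet S n p ↔ p = p₀ :=
      ⟨fun h => stepVec_injective (add_left_cancel (h.symm.trans hp₀)), fun h => h ▸ hp₀⟩
    have hval : S (n + 1) ω = S n ω + stepVec p₀ := hp₀
    simp only [Pi.sub_apply, Finset.sum_apply, Pi.mul_apply]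
    by_cases hp : ∃ k, J k = p₀.1
    · obtain ⟨k, hk⟩ := hp
      have hjk : jump (k, p₀.2) = p₀ := by simp [jump, hk]
      rw [Finset.sum_eq_single (k, p₀.2)]
      · rw [Set.indicator_of_mem ((hmem _).2 hjk)]
        simp [G, hjk, hval]
      · intro p _ hne
        rw [Set.indicator_of_notMem, mul_zero]
        rw [hmem, ← hjk]
        exact fun h => hne (hjump h)
      · simp
    · push Not at hp
      rw [Finset.sum_eq_zero, hval, sqNorm_add_stepVec_of_notMem _ hp, sub_self]
      intro p _
      rw [Set.indicator_of_notMem, mul_zero]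
      rw [hmem]
      exact fun h => hp p.1 (by rw [← h])
  have hcond : P[(fun ω => potential (sqNorm J (S n ω))) -
      (fun ω => potential (sqNorm J (S (n + 1) ω))) | histFiltration S hS.1 n]
      =ᵐ[P] ∑ p, P[(fun ω => G p (S n ω)) * (jumpSet S n (jump p)).indicator (1 : Ω → ℝ) |
        histFiltration S hS.1 n] :=
    (condExp_congr_ae hincr).trans (condExp_finsetSum (fun p _ =>
      (hint p).bdd_mul ((hadapted n (G p)).mono
        ((histFiltration S hS.1).le n)).aestronglyMeasurable
        (ae_of_all _ fun ω => hGbound p (S n ω))) _)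
  have hpull (p : Fin 3 × ℤˣ) := condExp_stronglyMeasurable_mul_of_bound
    ((histFiltration S hS.1).le n) (hadapted n (G p)) (hint p) _
    (ae_of_all P fun ω => hGbound p (S n ω))
  filter_upwards [hcond, ae_all_iff.2 hpull,
    ae_all_iff.2 fun p => hS.condExp_jumpSet hd₁ hd₁' hd₂ hd₂' n (jump p)] with ω h1 h2 h3
  rw [h1, Finset.sum_apply]
  simp only [h2, Pi.mul_apply, h3, jump, hunif, ← Finset.sum_mul]
  refine mul_nonneg ?_ (jumpProb_nonneg _ _)
  have := potential_superharmonic fun k => S n ω (J k)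
  rw [← neg_nonneg, ← Finset.sum_neg_distrib] at this
  simp only [neg_sub] at this
  simp only [G, jump, sqNorm_add_stepVec hJ]
  exact this

/-- The walk is transient when three coordinates are always equally likely to be moved and
one of them is moved infinitely often. -/
lemma IsBERW.isTransientWalk_of_three (hS : IsBERW d d₁ d₂ P S) (hd₁ : 1 ≤ d₁)
    (hd₁' : d₁ ≤ d) (hd₂ : 1 ≤ d₂) (hd₂' : d₂ ≤ d) {J : Fin 3 → Fin d}
    (hJ : Function.Injective J)
    (hunif : ∀ b k, jumpProb d d₁ d₂ b (J k) = jumpProb d d₁ d₂ b (J 0))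
    (hmove : ∀ᵐ ω ∂P, ∃ᶠ n in atTop, ω ∈ jumpSet S n (J 0, 1)) :
    IsTransientWalk d P S := by
  have hsuper := hS.supermartingale_potential hd₁ hd₁' hd₂ hd₂' hJ hunif
  have hconv := hsuper.neg.exists_ae_tendsto_of_bdd (R := (potential 0).toNNReal) fun n => by
    have hbound : ∀ᵐ ω ∂P, ‖(-fun n ω => potential (sqNorm J (S n ω))) n ω‖ ≤ potential 0 :=
      ae_of_all _ fun ω => by
        simp only [Pi.neg_apply, norm_neg]
        rw [Real.norm_of_nonneg (potential_nonneg (sqNorm_nonneg J _))]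
        exact potential_le (by norm_num) (sqNorm_nonneg J _)
    simpa [ENNReal.ofReal] using eLpNorm_le_of_ae_bound (p := 1) hbound
  filter_upwards [hconv, hmove] with ω hω hfreq x
  obtain ⟨L, hL⟩ := hω
  have hL' : Tendsto (fun n => potential (sqNorm J (S n ω))) atTop (nhds (-L)) := by
    simpa using hL.neg
  have hne := eventually_ne_of_tendsto_potential (fun n => sqNorm_nonneg J (S n ω)) hL'
    (hfreq.mono fun n hn => by
      have hn : S (n + 1) ω = S n ω + stepVec (J 0, 1) := hn
      rw [hn, sqNorm_add_stepVec hJ]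
      push_cast
      omega) (sqNorm J x)
  rw [← Nat.cofinite_eq_atTop, eventually_cofinite] at hne
  exact hne.subset fun n hn => by
    have hn : S n ω = x := hn
    simp [hn]

end Walk

/-- For `d ≥ 7` and `1 ≤ d₁, d₂ ≤ d` with `d₁ + d₂ > d`, setting `r := d₁ + d₂ − d`,
at least one of `r ≥ 3`, `d₁ − r ≥ 3`, `d₂ − r ≥ 3` holds; consequently, the
`M_d(d₁,d₂)` balanced excited random walk is transient. -/
theorem berw_transient_of_seven_le {Ω : Type*} [MeasurableSpace Ω]
    (P : Measure Ω) [IsProbabilityMeasure P] (d d₁ d₂ r : ℕ)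
    (hd : 7 ≤ d) (hd₁ : 1 ≤ d₁) (hd₁' : d₁ ≤ d) (hd₂ : 1 ≤ d₂) (hd₂' : d₂ ≤ d)
    (hover : d < d₁ + d₂) (hr : r = d₁ + d₂ - d)
    (S : ℕ → Ω → Fin d → ℤ) (hS : IsBERW d d₁ d₂ P S) :
    (3 ≤ r ∨ 3 ≤ d₁ - r ∨ 3 ≤ d₂ - r) ∧ IsTransientWalk d P S := by
  subst hr
  have hr3 : 3 ≤ d₁ + d₂ - d ∨ 3 ≤ d₁ - (d₁ + d₂ - d) ∨ 3 ≤ d₂ - (d₁ + d₂ - d) := by omega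
  refine ⟨hr3, ?_⟩
  have hi₁ : (⟨d - d₂, by omega⟩ : Fin d).1 < d₁ := by simp only; omega
  have hi₂ : d - d₂ ≤ (⟨d - d₂, by omega⟩ : Fin d).1 := le_rfl
  have hblock (a : ℕ) (ha : a + 3 ≤ d)
      (hall : ∀ b (k : Fin 3),
        Allowed d d₁ d₂ b ⟨a + k, by omega⟩ ↔ Allowed d d₁ d₂ b ⟨a, by omega⟩)
      (B : ℕ → Set Ω) (hB : ∀ n, MeasurableSet[histFiltration S hS.1 n] (B n))
      (hfreq : ∀ᵐ ω ∂P, ∃ᶠ n in atTop, ω ∈ B n)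
      (hallowed : ∀ n, ∀ ω ∈ B n, Allowed d d₁ d₂ (IsNewSite S n ω) ⟨a, by omega⟩) :
      IsTransientWalk d P S := by
    refine hS.isTransientWalk_of_three hd₁ hd₁' hd₂ hd₂'
      (J := fun k => ⟨a + k, by omega⟩) (fun k l h => ?_) (fun b k => ?_) ?_
    · simp only [Fin.mk.injEq] at h
      omega
    · classical exact if_congr ((hall b k).trans (hall b 0).symm) rfl rfl
    · filter_upwards [hfreq, hS.ae_frequently_jump hd₁ hd₁' hd₂ hd₂' (⟨a, by omega⟩, 1) hB
        hallowed] with ω h1 h2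
      exact (h2 h1).mono fun n hn => hn.2
  rcases hr3 with h | h | h
  · refine hblock (d - d₂) (by omega) (fun b k => ?_) (fun _ => Set.univ)
      (fun _ => MeasurableSet.univ) (ae_of_all _ fun ω => Frequently.of_forall fun _ => trivial)
      (fun n ω _ => ?_)
    · have := k.2
      simp only [Allowed]
      refine or_congr (and_congr_right fun _ => ?_) (and_congr_right fun _ => ?_) <;> omega
    · simp only [Allowed]
      by_cases hb : IsNewSite S n ω
      exacts [Or.inl ⟨hb, hi₁⟩, Or.inr ⟨hb, hi₂⟩]
  · refine hblock 0 (by omega) (fun b k => ?_) (fun n => {ω | IsNewSite S n ω})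
      (measurableSet_isNewSite hS.1) (hS.ae_frequently_new hd₁ hd₁' hd₂ hd₂' hi₁ hi₂)
      (fun n ω hω => Or.inl ⟨hω, hd₁⟩)
    have := k.2
    simp only [Allowed]
    refine or_congr (and_congr_right fun _ => ?_) (and_congr_right fun _ => ?_) <;> omega
  · refine hblock d₁ (by omega) (fun b k => ?_) (fun n => {ω | IsNewSite S n ω}ᶜ)
      (fun n => (measurableSet_isNewSite hS.1 n).compl)
      (hS.ae_frequently_old hd₁ hd₁' hd₂ hd₂' hi₁ hi₂)
      (fun n ω hω => Or.inr ⟨hω, ?_⟩)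
    · have := k.2
      simp only [Allowed]
      refine or_congr (and_congr_right fun _ => ?_) (and_congr_right fun _ => ?_) <;> omega
    · simp only; omega
end

section
/- The M₄(2,2) balanced excited random walk on ℤ⁴ (where at a newly visited site the walk takes a uniform step in ±e₁, ±e₂, and at a previously visited site a uniform step in ±e₃, ±e₄) is transient: almost surely every site of ℤ⁴ is visited only finitely many times. -/
open MeasureTheory Filter

namespace BERW

/-! ### The space of two independent sequences of fair four-sided coins -/

/-- Outcomes of two sequences of four-sided coins: the sequence `false` drives the first two
coordinates of the walk, the sequence `true` the last two. -/
abbrev Coins : Type := Bool × ℕ → Fin 4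

/-- The law of independent fair four-sided coins. -/
noncomputable def coinLaw : Measure Coins :=
  Measure.infinitePi fun _ => (PMF.uniformOfFintype (Fin 4)).toMeasure

instance : IsProbabilityMeasure coinLaw := by
  unfold coinLaw; infer_instance

/-- The event `A` only depends on the coins in the finite set `T`. -/
def DeterminedBy (T : Finset (Bool × ℕ)) (A : Set Coins) : Prop :=
  ∀ ω ω' : Coins, (∀ i ∈ T, ω i = ω' i) → ω ∈ A → ω' ∈ A

namespace DeterminedBy

variable {T T' : Finset (Bool × ℕ)} {A B : Set Coins}

lemma mem_iff (h : DeterminedBy T A) {ω ω' : Coins} (hω : ∀ i ∈ T, ω i = ω' i) :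
    ω ∈ A ↔ ω' ∈ A :=
  ⟨h ω ω' hω, h ω' ω fun i hi => (hω i hi).symm⟩

lemma mono (h : DeterminedBy T A) (hT : T ⊆ T') : DeterminedBy T' A :=
  fun ω ω' hω => h ω ω' fun i hi => hω i (hT hi)

lemma compl (h : DeterminedBy T A) : DeterminedBy T Aᶜ :=
  fun _ _ hω hA hA' => hA ((h.mem_iff hω).2 hA')

lemma eq_preimage (h : DeterminedBy T A) :
    A = (fun (ω : Coins) (i : T) => ω i) ⁻¹' ((fun (ω : Coins) (i : T) => ω i) '' A) := by
  ext ω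
  constructor
  · intro hω
    exact ⟨ω, hω, rfl⟩
  · rintro ⟨ω', hω', he⟩
    exact h ω' ω (fun i hi => congrFun he ⟨i, hi⟩) hω'

lemma measurableSet (h : DeterminedBy T A) : MeasurableSet A := by
  rw [h.eq_preimage]
  exact (measurable_pi_lambda _ fun i => measurable_pi_apply _) (Set.toFinite _).measurableSet

lemma measure_inter (hA : DeterminedBy T A) (hB : DeterminedBy T' B) (hT : Disjoint T T') :
    coinLaw (A ∩ B) = coinLaw A * coinLaw B := by
  have hind : ProbabilityTheory.iIndepFun (fun (i : Bool × ℕ) (ω : Coins) => ω i) coinLaw :=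
    ProbabilityTheory.iIndepFun_infinitePi (X := fun _ x => x) fun _ => measurable_id
  have h2 := hind.indepFun_finset T T' hT fun i => measurable_pi_apply i
  rw [hA.eq_preimage, hB.eq_preimage]
  exact h2.measure_inter_preimage_eq_mul _ _ (Set.toFinite _).measurableSet
    (Set.toFinite _).measurableSet

lemma measureReal_inter (hA : DeterminedBy T A) (hB : DeterminedBy T' B) (hT : Disjoint T T') :
    coinLaw.real (A ∩ B) = coinLaw.real A * coinLaw.real B := by
  simp [measureReal_def, hA.measure_inter hB hT, ENNReal.toReal_mul]

end DeterminedBy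

lemma coinLaw_eval (i : Bool × ℕ) (c : Fin 4) : coinLaw {ω | ω i = c} = 4⁻¹ := by
  have h := Measure.infinitePi_map_eval
    (μ := fun _ : Bool × ℕ => (PMF.uniformOfFintype (Fin 4)).toMeasure) i
  have : coinLaw {ω | ω i = c} = (coinLaw.map fun ω => ω i) {c} := by
    rw [Measure.map_apply (measurable_pi_apply i) (measurableSet_singleton c)]; rfl
  rw [this, coinLaw, h, PMF.toMeasure_apply_singleton _ _ (measurableSet_singleton c)]
  simp

lemma coinLaw_real_eval (i : Bool × ℕ) (c : Fin 4) : coinLaw.real {ω | ω i = c} = 1 / 4 := by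
  simp [measureReal_def, coinLaw_eval]

lemma determinedBy_eval (i : Bool × ℕ) (c : Fin 4) : DeterminedBy {i} {ω | ω i = c} :=
  fun ω ω' hω h => by
    have := hω i (Finset.mem_singleton_self i)
    simp only [Set.mem_ofPred_eq] at h ⊢
    rw [← this, h]

/-! ### The planar walks driven by the coins -/

/-- The four steps of the planar simple random walk. -/
def step : Fin 4 → ℤ × ℤ := ![(1, 0), (-1, 0), (0, 1), (0, -1)]

/-- The sum of the steps `s, …, t - 1` of the planar walk driven by the sequence `b`. -/
def increment (b : Bool) (s t : ℕ) (ω : Coins) : ℤ × ℤ :=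
  ∑ i ∈ Finset.Ico s t, step (ω (b, i))

/-- The coins with times in `[s, t)` of the sequence `b`. -/
def window (b : Bool) (s t : ℕ) : Finset (Bool × ℕ) := {b} ×ˢ Finset.Ico s t

lemma mem_window {b c : Bool} {s t i : ℕ} : (c, i) ∈ window b s t ↔ c = b ∧ s ≤ i ∧ i < t := by
  simp only [window, Finset.mem_product, Finset.mem_singleton, Finset.mem_Ico]

lemma window_subset {b : Bool} {s t s' t' : ℕ} (hs : s' ≤ s) (ht : t ≤ t') :
    window b s t ⊆ window b s' t' := by
  rintro ⟨c, i⟩ h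
  rw [mem_window] at h ⊢
  exact ⟨h.1, hs.trans h.2.1, h.2.2.trans_le ht⟩

lemma disjoint_window {b : Bool} {s t u : ℕ} : Disjoint (window b s t) (window b t u) := by
  rw [Finset.disjoint_left]
  rintro ⟨c, i⟩ h h'
  rw [mem_window] at h h'
  omega

lemma disjoint_window_not {b c : Bool} (h : b ≠ c) {s t s' t' : ℕ} :
    Disjoint (window b s t) (window c s' t') := by
  rw [Finset.disjoint_left]
  rintro ⟨e, i⟩ h1 h2
  rw [mem_window] at h1 h2
  exact h (h1.1.symm.trans h2.1)

lemma singleton_subset_window {b : Bool} {s t i : ℕ} (hs : s ≤ i) (ht : i < t) :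
    {(b, i)} ⊆ window b s t := by
  rw [Finset.singleton_subset_iff, mem_window]
  exact ⟨rfl, hs, ht⟩

lemma increment_congr {b : Bool} {s t : ℕ} {ω ω' : Coins}
    (h : ∀ i ∈ window b s t, ω i = ω' i) : increment b s t ω = increment b s t ω' :=
  Finset.sum_congr rfl fun i hi => by
    rw [h (b, i) (mem_window.2 ⟨rfl, Finset.mem_Ico.1 hi⟩)]

lemma determinedBy_increment (b : Bool) (s t : ℕ) (v : ℤ × ℤ) :
    DeterminedBy (window b s t) {ω | increment b s t ω = v} :=
  fun ω ω' hω h => by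
    simp only [Set.mem_ofPred_eq] at h ⊢
    rw [← increment_congr hω, h]

@[simp] lemma increment_self (b : Bool) (s : ℕ) (ω : Coins) : increment b s s ω = 0 := by
  simp [increment]

lemma increment_succ (b : Bool) {s t : ℕ} (h : s ≤ t) (ω : Coins) :
    increment b s (t + 1) ω = increment b s t ω + step (ω (b, t)) :=
  Finset.sum_Ico_succ_top h _

lemma increment_add (b : Bool) {s t u : ℕ} (hst : s ≤ t) (htu : t ≤ u) (ω : Coins) :
    increment b s t ω + increment b t u ω = increment b s u ω :=
  Finset.sum_Ico_consecutive _ hst htu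

/-! ### Heat kernel estimates -/

/-- The heat kernel of the one-dimensional simple random walk. -/
noncomputable def heat : ℕ → ℤ → ℝ
  | 0, u => if u = 0 then 1 else 0
  | s + 1, u => (heat s (u - 1) + heat s (u + 1)) / 2

lemma increment_law (b : Bool) (t s : ℕ) (v : ℤ × ℤ) :
    coinLaw.real {ω | increment b t (t + s) ω = v} =
      heat s (v.1 + v.2) * heat s (v.1 - v.2) := by
  induction s generalizing v with
  | zero =>
    obtain ⟨x, y⟩ := v
    simp only [add_zero, increment_self, heat]
    by_cases h : x = 0 ∧ y = 0
    · rw [h.1, h.2]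
      simp [← Prod.mk_zero_zero]
    · have h1 : ¬ ((0 : ℤ × ℤ) = (x, y)) := by
        intro h2; simp only [Prod.ext_iff, Prod.fst_zero, Prod.snd_zero] at h2; omega
      have h3 : ¬ (x + y = 0 ∧ x - y = 0) := by omega
      simp only [h1, Set.ofPred_false, measureReal_empty]
      by_cases h4 : x + y = 0
      · have : x - y ≠ 0 := fun h5 => h3 ⟨h4, h5⟩
        simp [this]
      · simp [h4]
  | succ s ih =>
    have hset : {ω | increment b t (t + (s + 1)) ω = v} =
        ⋃ c ∈ (Finset.univ : Finset (Fin 4)),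
          ({ω | increment b t (t + s) ω = v - step c} ∩ {ω | ω (b, t + s) = c}) := by
      ext ω
      simp only [Set.mem_ofPred_eq, Finset.mem_univ, Set.iUnion_true, Set.mem_iUnion,
        Set.mem_inter_iff, ← add_assoc, increment_succ b (Nat.le_add_right t s)]
      constructor
      · intro h
        exact ⟨_, by rw [← h]; simp, rfl⟩
      · rintro ⟨c, h, rfl⟩
        rw [h]; simp
    have hd : ∀ c, DeterminedBy (window b (t + s) (t + s + 1)) {ω | ω (b, t + s) = c} :=
      fun c => (determinedBy_eval _ c).mono (singleton_subset_window le_rfl (Nat.lt_succ_self _))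
    rw [hset, measureReal_biUnion_finset]
    · simp_rw [fun c => (determinedBy_increment b t (t + s) (v - step c)).measureReal_inter (hd c)
        disjoint_window, coinLaw_real_eval, ih]
      obtain ⟨x, y⟩ := v
      simp only [Fin.sum_univ_four, step, heat, Matrix.cons_val, Prod.mk_sub_mk]
      ring_nf
    · intro c _ c' _ hcc
      refine Set.disjoint_left.2 ?_
      rintro ω ⟨_, h1⟩ ⟨_, h2⟩
      exact hcc (h1.symm.trans h2)
    · intro c _
      exact (determinedBy_increment _ _ _ _).measurableSet.inter (hd c).measurableSet

lemma heat_eq_choose (s i : ℕ) : heat s (2 * i - s) = s.choose i / 2 ^ s := by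
  induction s generalizing i with
  | zero =>
    rcases i with _ | i
    · simp [heat]
    · have : ¬ (2 * ((i : ℤ) + 1) = 0) := by omega
      simp [heat, this]
  | succ s ih =>
    rcases i with _ | i
    · have h1 : ∀ (s : ℕ) (u : ℤ), u < - s → heat s u = 0 := by
        intro s
        induction s with
        | zero => intro u hu; simp only [heat]; rw [if_neg]; push_cast at hu; omega
        | succ s ih' =>
          intro u hu
          push_cast at hu
          simp only [heat]
          rw [ih' _ (by omega), ih' _ (by omega)]; simp
      have h2 := ih 0
      simp only [heat]
      rw [h1 s _ (by push_cast; omega)]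
      have : (2 * ((0 : ℕ) : ℤ) - ((s + 1 : ℕ) : ℤ) + 1) = 2 * ((0 : ℕ) : ℤ) - s := by
        push_cast; ring
      rw [this, h2]
      simp only [Nat.choose_zero_right, pow_succ]
      push_cast
      field_simp
      ring
    · have h1 := ih i
      have h2 := ih (i + 1)
      simp only [heat]
      have e1 : (2 * ((i + 1 : ℕ) : ℤ) - ((s + 1 : ℕ) : ℤ) - 1) = 2 * (i : ℤ) - s := by
        push_cast; ring
      have e2 : (2 * ((i + 1 : ℕ) : ℤ) - ((s + 1 : ℕ) : ℤ) + 1) = 2 * ((i + 1 : ℕ) : ℤ) - s := by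
        push_cast; ring
      rw [e1, e2, h1, h2, Nat.choose_succ_succ, pow_succ]
      push_cast
      field_simp

lemma heat_eq_zero_or (s : ℕ) (u : ℤ) : heat s u = 0 ∨ ∃ i : ℕ, u = 2 * i - s := by
  induction s generalizing u with
  | zero =>
    by_cases h : u = 0
    · exact Or.inr ⟨0, by simp [h]⟩
    · exact Or.inl (by simp [heat, h])
  | succ s ih =>
    rcases ih (u - 1) with h1 | ⟨i, hi⟩
    · rcases ih (u + 1) with h2 | ⟨i, hi⟩
      · left; simp [heat, h1, h2]
      · right; exact ⟨i, by push_cast; omega⟩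
    · right; exact ⟨i + 1, by push_cast; omega⟩

lemma centralBinom_sq_le (m : ℕ) : ((m.centralBinom : ℝ) / 4 ^ m) ^ 2 ≤ 1 / (2 * m + 1) := by
  induction m with
  | zero => simp
  | succ m ih =>
    have h : ((m + 1 : ℕ) : ℝ) * (m + 1).centralBinom = 2 * (2 * m + 1) * m.centralBinom := by
      exact_mod_cast Nat.succ_mul_centralBinom_succ m
    have h' : ((m + 1).centralBinom : ℝ) / 4 ^ (m + 1) =
        ((2 * m + 1) / (2 * m + 2)) * (m.centralBinom / 4 ^ m) := by
      push_cast at h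
      rw [pow_succ]
      field_simp
      linarith
    rw [h', mul_pow]
    refine (mul_le_mul_of_nonneg_left ih (by positivity)).trans ?_
    push_cast
    rw [div_pow, div_mul_div_comm, div_le_div_iff₀ (by positivity) (by positivity)]
    have : (0 : ℝ) ≤ m := Nat.cast_nonneg m
    nlinarith [mul_nonneg this this, mul_nonneg (mul_nonneg this this) this]

lemma le_centralBinom_sq (m : ℕ) :
    1 / (4 * ((m : ℝ) + 1)) ≤ ((m.centralBinom : ℝ) / 4 ^ m) ^ 2 := by
  rcases Nat.eq_zero_or_pos m with rfl | hm
  · norm_num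
  have key : 1 / (4 * (m : ℝ)) ≤ ((m.centralBinom : ℝ) / 4 ^ m) ^ 2 := by
    induction m, hm using Nat.le_induction with
    | base => norm_num [Nat.centralBinom, Nat.choose]
    | succ m hm ih =>
      have h : ((m + 1 : ℕ) : ℝ) * (m + 1).centralBinom = 2 * (2 * m + 1) * m.centralBinom := by
        exact_mod_cast Nat.succ_mul_centralBinom_succ m
      have h' : ((m + 1).centralBinom : ℝ) / 4 ^ (m + 1) =
          ((2 * m + 1) / (2 * m + 2)) * (m.centralBinom / 4 ^ m) := by
        push_cast at h
        rw [pow_succ]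
        field_simp
        linarith
      rw [h', mul_pow]
      refine le_trans ?_ (mul_le_mul_of_nonneg_left ih (by positivity))
      have h1 : (1 : ℝ) ≤ m := by exact_mod_cast hm
      push_cast
      rw [div_pow, div_mul_div_comm, div_le_div_iff₀ (by positivity) (by positivity)]
      nlinarith
  refine le_trans ?_ key
  have h1 : (1 : ℝ) ≤ m := by exact_mod_cast hm
  exact one_div_le_one_div_of_le (by positivity) (by linarith)

lemma choose_div_two_pow_sq_le (s i : ℕ) : ((s.choose i : ℝ) / 2 ^ s) ^ 2 ≤ 1 / (s + 1) := by
  rcases Nat.even_or_odd' s with ⟨m, rfl | rfl⟩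
  · refine le_trans ?_ ((centralBinom_sq_le m).trans_eq (by push_cast; ring))
    have : (2 : ℝ) ^ (2 * m) = 4 ^ m := by rw [pow_mul]; norm_num
    rw [this]
    gcongr
    exact Nat.choose_le_centralBinom i m
  · have h1 : ((2 * m + 1).choose i : ℝ) ≤ (2 * m + 1).choose m := by
      have := Nat.choose_le_middle i (2 * m + 1)
      have e : (2 * m + 1) / 2 = m := by omega
      rw [e] at this
      exact_mod_cast this
    have h2 : ((m + 1).centralBinom : ℝ) = 2 * (2 * m + 1).choose m := by
      have h3 : (2 * m + 1).choose (m + 1) = (2 * m + 1).choose m :=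
        Nat.choose_symm_half m
      have h4 : (m + 1).centralBinom = (2 * m + 1).choose m + (2 * m + 1).choose (m + 1) := by
        rw [Nat.centralBinom, ← Nat.choose_succ_succ]; rfl
      rw [h4, h3]; push_cast; ring
    have h3 := centralBinom_sq_le (m + 1)
    have : (2 : ℝ) ^ (2 * m + 1) * 2 = 4 ^ (m + 1) := by
      rw [← pow_succ, show 2 * m + 1 + 1 = 2 * (m + 1) by ring, pow_mul]; norm_num
    rw [h2, ← this] at h3
    have h5 : (2 * ((2 * m + 1).choose m : ℝ)) / (2 ^ (2 * m + 1) * 2) =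
        ((2 * m + 1).choose m : ℝ) / 2 ^ (2 * m + 1) := by field_simp
    rw [h5] at h3
    calc (((2 * m + 1).choose i : ℝ) / 2 ^ (2 * m + 1)) ^ 2
        ≤ (((2 * m + 1).choose m : ℝ) / 2 ^ (2 * m + 1)) ^ 2 := by gcongr
      _ ≤ _ := h3
      _ ≤ _ := by
        push_cast
        exact one_div_le_one_div_of_le (by positivity) (by linarith)

lemma heat_sq_le (s : ℕ) (u : ℤ) : heat s u ^ 2 ≤ 1 / (s + 1) := by
  rcases heat_eq_zero_or s u with h | ⟨i, rfl⟩
  · rw [h, zero_pow two_ne_zero]; positivity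
  · rw [heat_eq_choose]; exact choose_div_two_pow_sq_le s i

lemma increment_law_le (b : Bool) (t s : ℕ) (v : ℤ × ℤ) :
    coinLaw.real {ω | increment b t (t + s) ω = v} ≤ 1 / (s + 1) := by
  rw [increment_law]
  nlinarith [heat_sq_le s (v.1 + v.2), heat_sq_le s (v.1 - v.2),
    sq_nonneg (heat s (v.1 + v.2) - heat s (v.1 - v.2))]

lemma le_increment_law_zero (b : Bool) (t m : ℕ) :
    1 / (4 * ((m : ℝ) + 1)) ≤ coinLaw.real {ω | increment b t (t + 2 * m) ω = 0} := by
  have h := heat_eq_choose (2 * m) m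
  have e : (2 * (m : ℤ) - ((2 * m : ℕ) : ℤ)) = 0 := by push_cast; ring
  have : (2 : ℝ) ^ (2 * m) = 4 ^ m := by rw [pow_mul]; norm_num
  rw [e, this, ← Nat.centralBinom_eq_two_mul_choose] at h
  rw [increment_law]
  simp only [Prod.fst_zero, Prod.snd_zero, add_zero, sub_zero, h, ← sq]
  exact le_centralBinom_sq m

lemma sum_Ico_two_pow_le {p q : ℕ} (h : p ≤ q) :
    ∑ k ∈ Finset.Ico ((2 : ℕ) ^ p) (2 ^ q), 1 / ((k : ℝ) + 1) ≤ q - p := by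
  induction q, h using Nat.le_induction with
  | base => simp
  | succ q h ih =>
    rw [← Finset.sum_Ico_consecutive _ (Nat.pow_le_pow_right two_pos h)
      (Nat.pow_le_pow_right two_pos q.le_succ)]
    have : ∑ k ∈ Finset.Ico ((2 : ℕ) ^ q) (2 ^ (q + 1)), 1 / ((k : ℝ) + 1) ≤ 1 := by
      calc ∑ k ∈ Finset.Ico ((2 : ℕ) ^ q) (2 ^ (q + 1)), 1 / ((k : ℝ) + 1)
          ≤ ∑ k ∈ Finset.Ico ((2 : ℕ) ^ q) (2 ^ (q + 1)), 1 / (2 : ℝ) ^ q := by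
            refine Finset.sum_le_sum fun k hk => ?_
            have : (2 : ℝ) ^ q ≤ k := by exact_mod_cast (Finset.mem_Ico.1 hk).1
            exact one_div_le_one_div_of_le (by positivity) (by linarith)
        _ = 1 := by
            rw [Finset.sum_const, Nat.card_Ico, pow_succ, mul_two, Nat.add_sub_cancel]
            simp
    push_cast
    linarith

lemma le_sum_range_two_pow (q : ℕ) :
    (q : ℝ) / 2 ≤ ∑ k ∈ Finset.range ((2 : ℕ) ^ q), 1 / ((k : ℝ) + 1) := by
  induction q with
  | zero => simp
  | succ q ih =>
    rw [← Finset.sum_range_add_sum_Ico _ (Nat.pow_le_pow_right two_pos q.le_succ)]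
    have : 1 / 2 ≤ ∑ k ∈ Finset.Ico ((2 : ℕ) ^ q) (2 ^ (q + 1)), 1 / ((k : ℝ) + 1) := by
      calc (1 : ℝ) / 2 = ∑ k ∈ Finset.Ico ((2 : ℕ) ^ q) (2 ^ (q + 1)), 1 / (2 : ℝ) ^ (q + 1) := by
            rw [Finset.sum_const, Nat.card_Ico, pow_succ, mul_two, Nat.add_sub_cancel]
            simp
            field_simp
            ring
        _ ≤ _ := by
            refine Finset.sum_le_sum fun k hk => ?_
            have : (k : ℝ) + 1 ≤ 2 ^ (q + 1) := by exact_mod_cast (Finset.mem_Ico.1 hk).2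
            exact one_div_le_one_div_of_le (by positivity) (by linarith)
    push_cast
    linarith

/-! ### Hitting a site -/

/-- The planar walk driven by `b` visits `v` at a time in `[a, c)`. -/
def hits (b : Bool) (a c : ℕ) (v : ℤ × ℤ) : Set Coins :=
  {ω | ∃ t, a ≤ t ∧ t < c ∧ increment b 0 t ω = v}

/-- The planar walk driven by `b` visits `v` at time `t`, for the first time after time `a`. -/
def firstHit (b : Bool) (a : ℕ) (v : ℤ × ℤ) (t : ℕ) : Set Coins :=
  {ω | increment b 0 t ω = v ∧ ∀ u, a ≤ u → u < t → increment b 0 u ω ≠ v}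

lemma increment_congr_of_le {b : Bool} {t u : ℕ} {ω ω' : Coins} (hu : u ≤ t)
    (h : ∀ i ∈ window b 0 t, ω i = ω' i) : increment b 0 u ω = increment b 0 u ω' :=
  increment_congr fun i hi => h i (window_subset le_rfl hu hi)

lemma determinedBy_hits (b : Bool) (a c : ℕ) (v : ℤ × ℤ) :
    DeterminedBy (window b 0 c) (hits b a c v) := by
  rintro ω ω' h ⟨t, h1, h2, h3⟩
  exact ⟨t, h1, h2, by rw [← increment_congr_of_le h2.le h, h3]⟩

lemma determinedBy_firstHit (b : Bool) (a : ℕ) (v : ℤ × ℤ) (t : ℕ) :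
    DeterminedBy (window b 0 t) (firstHit b a v t) := by
  rintro ω ω' h ⟨h1, h2⟩
  refine ⟨by rw [← increment_congr h, h1], fun u h3 h4 => ?_⟩
  rw [← increment_congr_of_le h4.le h]
  exact h2 u h3 h4

lemma disjoint_firstHit {b : Bool} {a : ℕ} {v : ℤ × ℤ} {t u : ℕ} (ht : a ≤ t) (hu : a ≤ u)
    (h : t ≠ u) : Disjoint (firstHit b a v t) (firstHit b a v u) := by
  rw [Set.disjoint_left]
  rintro ω ⟨h1, h2⟩ ⟨h3, h4⟩
  rcases h.lt_or_gt with h | h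
  · exact h4 t ht h h1
  · exact h2 u hu h h3

lemma hits_subset (b : Bool) (a c : ℕ) (v : ℤ × ℤ) :
    hits b a c v ⊆ ⋃ t ∈ Finset.Ico a c, firstHit b a v t := by
  classical
  rintro ω ⟨t, h1, h2, h3⟩
  have hex : ∃ t, a ≤ t ∧ increment b 0 t ω = v := ⟨t, h1, h3⟩
  have hle : Nat.find hex ≤ t := Nat.find_min' hex ⟨h1, h3⟩
  simp only [Set.mem_iUnion, Finset.mem_Ico]
  exact ⟨Nat.find hex, ⟨(Nat.find_spec hex).1, hle.trans_lt h2⟩, (Nat.find_spec hex).2,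
    fun u h4 h5 h6 => Nat.find_min hex h5 ⟨h4, h6⟩⟩

lemma measure_hits_mul_le (b : Bool) (a c M : ℕ) (v : ℤ × ℤ) :
    coinLaw.real (hits b a c v) * ∑ m ∈ Finset.range M, 1 / (4 * ((m : ℝ) + 1)) ≤
      ∑ k ∈ Finset.Ico a (c + 2 * M), 1 / ((k : ℝ) + 1) := by
  have hF : coinLaw.real (hits b a c v) ≤ ∑ t ∈ Finset.Ico a c, coinLaw.real (firstHit b a v t) :=
    (measureReal_mono (hits_subset b a c v) (measure_ne_top _ _)).trans (measureReal_biUnion_finset_le _ _)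
  have hret : ∀ t m : ℕ, coinLaw.real (firstHit b a v t) * (1 / (4 * ((m : ℝ) + 1))) ≤
      coinLaw.real (firstHit b a v t ∩ {ω | increment b 0 (t + 2 * m) ω = v}) := by
    intro t m
    calc _ ≤ coinLaw.real (firstHit b a v t) *
          coinLaw.real {ω | increment b t (t + 2 * m) ω = 0} :=
          mul_le_mul_of_nonneg_left (le_increment_law_zero b t m) measureReal_nonneg
      _ = coinLaw.real (firstHit b a v t ∩ {ω | increment b t (t + 2 * m) ω = 0}) :=
          ((determinedBy_firstHit b a v t).measureReal_inter (determinedBy_increment b t _ 0)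
            disjoint_window).symm
      _ ≤ _ := by
          refine measureReal_mono ?_
          rintro ω ⟨h1, h2⟩
          refine ⟨h1, ?_⟩
          simp only [Set.mem_ofPred_eq] at h2 ⊢
          rw [← increment_add b (Nat.zero_le t) (Nat.le_add_right t (2 * m)), h1.1, h2, add_zero]
  calc _ ≤ (∑ t ∈ Finset.Ico a c, coinLaw.real (firstHit b a v t)) *
        ∑ m ∈ Finset.range M, 1 / (4 * ((m : ℝ) + 1)) :=
        mul_le_mul_of_nonneg_right hF (Finset.sum_nonneg fun _ _ => by positivity)
    _ = ∑ t ∈ Finset.Ico a c, ∑ m ∈ Finset.range M,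
          coinLaw.real (firstHit b a v t) * (1 / (4 * ((m : ℝ) + 1))) := Finset.sum_mul_sum _ _ _ _
    _ ≤ ∑ t ∈ Finset.Ico a c, ∑ k ∈ Finset.Ico a (c + 2 * M),
          coinLaw.real (firstHit b a v t ∩ {ω | increment b 0 k ω = v}) := by
        refine Finset.sum_le_sum fun t ht => ?_
        rw [Finset.mem_Ico] at ht
        refine (Finset.sum_le_sum fun m _ => hret t m).trans ?_
        have hinj : Set.InjOn (fun m : ℕ => t + 2 * m) (Finset.range M : Set ℕ) := by
          intro x _ y _ hxy
          simp only at hxy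
          omega
        rw [← Finset.sum_image (f := fun k =>
          coinLaw.real (firstHit b a v t ∩ {ω | increment b 0 k ω = v})) hinj]
        refine Finset.sum_le_sum_of_subset_of_nonneg ?_ fun _ _ _ => measureReal_nonneg
        intro k hk
        obtain ⟨m, hm, rfl⟩ := Finset.mem_image.1 hk
        rw [Finset.mem_range] at hm
        rw [Finset.mem_Ico]
        omega
    _ = ∑ k ∈ Finset.Ico a (c + 2 * M), ∑ t ∈ Finset.Ico a c,
          coinLaw.real (firstHit b a v t ∩ {ω | increment b 0 k ω = v}) := Finset.sum_comm
    _ ≤ _ := by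
        refine Finset.sum_le_sum fun k _ => ?_
        rw [← measureReal_biUnion_finset]
        · refine (measureReal_mono (s₂ := {ω | increment b 0 k ω = v}) ?_).trans ?_
          · intro ω hω
            simp only [Set.mem_iUnion] at hω
            obtain ⟨t, _, h⟩ := hω
            exact h.2
          · simpa using increment_law_le b 0 k v
        · intro t ht u hu htu
          rw [Finset.mem_coe, Finset.mem_Ico] at ht hu
          exact (disjoint_firstHit ht.1 hu.1 htu).mono Set.inter_subset_left Set.inter_subset_left
        · intro t _
          exact (determinedBy_firstHit b a v t).measurableSet.inter
            (determinedBy_increment b 0 k v).measurableSet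

lemma measure_hits_two_pow_mul_le (b : Bool) {p q : ℕ} (h : p ≤ q + 1) (v : ℤ × ℤ) :
    coinLaw.real (hits b (2 ^ p) (2 ^ (q + 1)) v) * (q / 8) ≤ q + 2 - p := by
  have h1 := measure_hits_mul_le b (2 ^ p) (2 ^ (q + 1)) (2 ^ q) v
  have e : 2 ^ (q + 1) + 2 * 2 ^ q = 2 ^ (q + 2) := by ring
  rw [e] at h1
  have h2 := sum_Ico_two_pow_le (p := p) (q := q + 2) (by omega)
  have h3 : (q : ℝ) / 8 ≤ ∑ m ∈ Finset.range (2 ^ q), 1 / (4 * ((m : ℝ) + 1)) := by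
    have := le_sum_range_two_pow q
    have e2 : ∑ m ∈ Finset.range (2 ^ q), 1 / (4 * ((m : ℝ) + 1)) =
        (∑ m ∈ Finset.range (2 ^ q), 1 / ((m : ℝ) + 1)) / 4 := by
      rw [Finset.sum_div]
      refine Finset.sum_congr rfl fun m _ => ?_
      rw [div_div, mul_comm]
    rw [e2]
    linarith
  push_cast at h2
  exact ((mul_le_mul_of_nonneg_left h3 measureReal_nonneg).trans h1).trans h2

/-! ### The range of the planar walk -/

/-- The set of sites visited by the planar walk driven by `b` before time `m`. -/
def trace (b : Bool) (m : ℕ) (ω : Coins) : Finset (ℤ × ℤ) :=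
  (Finset.range m).image fun i => increment b 0 i ω

/-- The set of outcomes for which the planar walk is at the same site at times `i` and `j`. -/
def collision (b : Bool) (i j : ℕ) : Set Coins := {ω | increment b 0 i ω = increment b 0 j ω}

lemma collision_comm (b : Bool) (i j : ℕ) : collision b i j = collision b j i := by
  ext ω; exact eq_comm

lemma collision_eq (b : Bool) (i k : ℕ) :
    collision b i (i + k) = {ω | increment b i (i + k) ω = 0} := by
  ext ω
  simp only [collision, Set.mem_ofPred_eq]
  rw [← increment_add b (Nat.zero_le i) (Nat.le_add_right i k)]
  exact left_eq_add

lemma measurableSet_collision (b : Bool) (i j : ℕ) : MeasurableSet (collision b i j) := by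
  wlog h : i ≤ j generalizing i j
  · rw [collision_comm]; exact this j i (le_of_not_ge h)
  obtain ⟨k, rfl⟩ := Nat.exists_eq_add_of_le h
  rw [collision_eq]
  exact (determinedBy_increment _ _ _ _).measurableSet

/-- The number of pairs of times at which the planar walk is at the same site. -/
noncomputable def collisions (b : Bool) (m : ℕ) (ω : Coins) : ℝ :=
  ∑ i ∈ Finset.range m, ∑ j ∈ Finset.range m, (collision b i j).indicator 1 ω

lemma sq_le_card_trace_mul_collisions (b : Bool) (m : ℕ) (ω : Coins) :
    (m : ℝ) ^ 2 ≤ (trace b m ω).card * collisions b m ω := by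
  classical
  have h1 : (m : ℝ) = ∑ x ∈ trace b m ω,
      (((Finset.range m).filter fun i => increment b 0 i ω = x).card : ℝ) := by
    have := Finset.card_eq_sum_card_image (fun i => increment b 0 i ω) (Finset.range m)
    rw [Finset.card_range] at this
    exact_mod_cast this
  have h2 : collisions b m ω = ∑ x ∈ trace b m ω,
      (((Finset.range m).filter fun i => increment b 0 i ω = x).card : ℝ) ^ 2 := by
    have h3 := Finset.sum_comp (s := Finset.range m)
      (fun x => (((Finset.range m).filter fun i => increment b 0 i ω = x).card : ℝ))
      (fun i => increment b 0 i ω)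
    simp only [nsmul_eq_mul, ← sq] at h3
    rw [trace, ← h3, collisions]
    refine Finset.sum_congr rfl fun i _ => ?_
    rw [Finset.card_filter, Nat.cast_sum]
    refine Finset.sum_congr rfl fun j _ => ?_
    simp [Set.indicator_apply, collision, eq_comm]
  rw [h2]
  conv_lhs => rw [h1]
  exact sq_sum_le_card_mul_sum_sq

lemma sum_range_two_pow_le (q : ℕ) :
    ∑ k ∈ Finset.range ((2 : ℕ) ^ q), 1 / ((k : ℝ) + 1) ≤ q + 1 := by
  have h := sum_Ico_two_pow_le (Nat.zero_le q)
  rw [Finset.range_eq_Ico, ← Finset.sum_Ico_consecutive _ (Nat.zero_le 1) Nat.one_le_two_pow]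
  simp only [pow_zero] at h
  norm_num at h ⊢
  linarith

lemma integral_collisions_le (b : Bool) (q : ℕ) :
    ∫ ω, collisions b (2 ^ q) ω ∂coinLaw ≤ 2 ^ q * (2 * (q + 1)) := by
  have hinteg : ∀ i j, Integrable ((collision b i j).indicator (1 : Coins → ℝ)) coinLaw :=
    fun i j => (integrable_const (1 : ℝ)).indicator (measurableSet_collision b i j)
  have hP : ∀ i k, coinLaw.real (collision b i (i + k)) ≤ 1 / (k + 1) := fun i k => by
    rw [collision_eq]; exact increment_law_le b i k 0
  have hrow : ∀ i ∈ Finset.range ((2 : ℕ) ^ q), ∑ j ∈ Finset.range (2 ^ q),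
      coinLaw.real (collision b i j) ≤ 2 * ((q : ℝ) + 1) := by
    intro i hi
    rw [Finset.mem_range] at hi
    have h1 : ∑ j ∈ Finset.range i, coinLaw.real (collision b i j) ≤ q + 1 := by
      rw [← Finset.sum_range_reflect]
      calc _ ≤ ∑ k ∈ Finset.range i, 1 / ((k : ℝ) + 1) := by
            refine Finset.sum_le_sum fun k hk => ?_
            rw [Finset.mem_range] at hk
            have e : i - 1 - k + (k + 1) = i := by omega
            have := hP (i - 1 - k) (k + 1)
            rw [e] at this
            rw [collision_comm]
            refine this.trans (one_div_le_one_div_of_le (by positivity) ?_)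
            push_cast
            linarith
        _ ≤ ∑ k ∈ Finset.range (2 ^ q), 1 / ((k : ℝ) + 1) :=
            Finset.sum_le_sum_of_subset_of_nonneg (Finset.range_mono hi.le)
              fun _ _ _ => by positivity
        _ ≤ _ := sum_range_two_pow_le q
    have h2 : ∑ j ∈ Finset.Ico i (2 ^ q), coinLaw.real (collision b i j) ≤ q + 1 := by
      rw [Finset.sum_Ico_eq_sum_range]
      calc _ ≤ ∑ k ∈ Finset.range (2 ^ q - i), 1 / ((k : ℝ) + 1) :=
            Finset.sum_le_sum fun k _ => hP i k
        _ ≤ ∑ k ∈ Finset.range (2 ^ q), 1 / ((k : ℝ) + 1) :=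
            Finset.sum_le_sum_of_subset_of_nonneg (Finset.range_mono (Nat.sub_le _ _))
              fun _ _ _ => by positivity
        _ ≤ _ := sum_range_two_pow_le q
    rw [← Finset.sum_range_add_sum_Ico _ hi.le]
    linarith
  simp only [collisions]
  rw [integral_finsetSum _ fun i _ => integrable_finsetSum _ fun j _ => hinteg i j]
  simp_rw [integral_finsetSum _ fun j _ => hinteg _ j,
    integral_indicator_one (measurableSet_collision b _ _)]
  refine (Finset.sum_le_sum hrow).trans_eq ?_
  simp

lemma measure_card_trace_le (b : Bool) (q K : ℕ) (hK : 0 < K) :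
    coinLaw.real {ω | (trace b (2 ^ q) ω).card * K ≤ 2 ^ q} ≤ 2 * (q + 1) / K := by
  have hK' : (0 : ℝ) < K := by exact_mod_cast hK
  have h2 : (0 : ℝ) < 2 ^ q := by positivity
  have hnonneg : ∀ ω, 0 ≤ collisions b (2 ^ q) ω := fun ω =>
    Finset.sum_nonneg fun _ _ => Finset.sum_nonneg fun _ _ =>
      Set.indicator_nonneg (fun _ _ => zero_le_one) _
  have hsub : {ω | (trace b (2 ^ q) ω).card * K ≤ 2 ^ q} ⊆
      {ω | (2 : ℝ) ^ q * K ≤ collisions b (2 ^ q) ω} := by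
    intro ω hω
    simp only [Set.mem_ofPred_eq] at hω ⊢
    have h1 := sq_le_card_trace_mul_collisions b (2 ^ q) ω
    have h3 : ((trace b (2 ^ q) ω).card : ℝ) * K ≤ 2 ^ q := by exact_mod_cast hω
    push_cast at h1
    have h4 : (2 : ℝ) ^ q * (2 ^ q * K) ≤ 2 ^ q * collisions b (2 ^ q) ω := by
      calc (2 : ℝ) ^ q * (2 ^ q * K) = (2 ^ q) ^ 2 * K := by ring
        _ ≤ ((trace b (2 ^ q) ω).card * collisions b (2 ^ q) ω) * K := by gcongr
        _ = ((trace b (2 ^ q) ω).card * K) * collisions b (2 ^ q) ω := by ring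
        _ ≤ _ := mul_le_mul_of_nonneg_right h3 (hnonneg ω)
    exact le_of_mul_le_mul_left h4 h2
  have hinteg : Integrable (collisions b (2 ^ q)) coinLaw :=
    integrable_finsetSum _ fun i _ => integrable_finsetSum _ fun j _ =>
      (integrable_const (1 : ℝ)).indicator (measurableSet_collision b i j)
  have hM := mul_meas_ge_le_integral_of_nonneg (Filter.Eventually.of_forall hnonneg) hinteg
    ((2 : ℝ) ^ q * K)
  have hM' := hM.trans (integral_collisions_le b q)
  refine (measureReal_mono hsub).trans ?_
  rw [le_div_iff₀ hK']
  rw [mul_assoc] at hM'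
  have := le_of_mul_le_mul_left hM' h2
  linarith

/-! ### Reversals -/

/-- The index of the step opposite to a given step. -/
def opposite : Fin 4 → Fin 4 := ![1, 0, 3, 2]

lemma step_add_step_opposite (c : Fin 4) : step c + step (opposite c) = 0 := by
  fin_cases c <;> decide

/-- Step `2 * i + 1` of the first planar walk is opposite to step `2 * i`. -/
def reversal (i : ℕ) : Set Coins :=
  {ω | ω (false, 2 * i + 1) = opposite (ω (false, 2 * i))}

open Classical in
/-- The number of `i < m` such that step `2 * i + 1` of the first planar walk is opposite to
step `2 * i`. -/
noncomputable def reversals (m : ℕ) (ω : Coins) : ℕ :=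
  ((Finset.range m).filter fun i => ω ∈ reversal i).card

lemma reversals_succ_of_mem {m : ℕ} {ω : Coins} (h : ω ∈ reversal m) :
    reversals (m + 1) ω = reversals m ω + 1 := by
  simp [reversals, Finset.range_add_one, Finset.filter_insert, h]

lemma reversals_succ_of_notMem {m : ℕ} {ω : Coins} (h : ω ∉ reversal m) :
    reversals (m + 1) ω = reversals m ω := by
  simp [reversals, Finset.range_add_one, Finset.filter_insert, h]

lemma reversals_mono {m m' : ℕ} (h : m ≤ m') (ω : Coins) : reversals m ω ≤ reversals m' ω := by
  classical
  unfold reversals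
  exact Finset.card_le_card (Finset.filter_subset_filter _ (Finset.range_mono h))

lemma determinedBy_reversal (i : ℕ) :
    DeterminedBy (window false (2 * i) (2 * (i + 1))) (reversal i) := by
  intro ω ω' h hω
  have h1 := h (false, 2 * i) (mem_window.2 ⟨rfl, by omega, by omega⟩)
  have h2 := h (false, 2 * i + 1) (mem_window.2 ⟨rfl, by omega, by omega⟩)
  simp only [reversal, Set.mem_ofPred_eq] at hω ⊢
  rw [← h1, ← h2, hω]

lemma reversals_congr {m : ℕ} {ω ω' : Coins}
    (h : ∀ i ∈ window false 0 (2 * m), ω i = ω' i) : reversals m ω = reversals m ω' := by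
  classical
  unfold reversals
  congr 1
  refine Finset.filter_congr fun i hi => ?_
  rw [Finset.mem_range] at hi
  exact (determinedBy_reversal i).mem_iff fun j hj =>
    h j (window_subset (Nat.zero_le _) (by omega) hj)

lemma measure_reversal (i : ℕ) : coinLaw.real (reversal i) = 1 / 4 := by
  have hset : reversal i = ⋃ c ∈ (Finset.univ : Finset (Fin 4)),
      ({ω : Coins | ω (false, 2 * i) = c} ∩ {ω | ω (false, 2 * i + 1) = opposite c}) := by
    ext ω
    simp [reversal]
  have hdisj : Disjoint ({(false, 2 * i)} : Finset (Bool × ℕ)) {(false, 2 * i + 1)} := by simp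
  rw [hset, measureReal_biUnion_finset]
  · simp_rw [fun c => (determinedBy_eval (false, 2 * i) c).measureReal_inter
      (determinedBy_eval (false, 2 * i + 1) (opposite c)) hdisj, coinLaw_real_eval]
    norm_num
  · intro c _ c' _ hcc
    refine Set.disjoint_left.2 ?_
    rintro ω ⟨h1, _⟩ ⟨h2, _⟩
    exact hcc (h1.symm.trans h2)
  · intro c _
    exact (determinedBy_eval _ _).measurableSet.inter (determinedBy_eval _ _).measurableSet

lemma measure_reversals_le (m k : ℕ) :
    coinLaw.real {ω | reversals m ω ≤ k} ≤ 2 ^ k * (7 / 8) ^ m := by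
  induction m generalizing k with
  | zero =>
    refine measureReal_le_one.trans ?_
    simpa using one_le_pow₀ (one_le_two (α := ℝ))
  | succ m ih =>
    have hdet : ∀ k, DeterminedBy (window false 0 (2 * m)) {ω | reversals m ω ≤ k} :=
      fun k ω ω' h hω => by
        simp only [Set.mem_ofPred_eq] at hω ⊢
        rwa [← reversals_congr h]
    have hcompl : coinLaw.real (reversal m)ᶜ = 3 / 4 := by
      rw [probReal_compl_eq_one_sub (determinedBy_reversal m).measurableSet, measure_reversal]
      norm_num
    have h1 : coinLaw.real ({ω | reversals m ω ≤ k} ∩ (reversal m)ᶜ) ≤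
        2 ^ k * (7 / 8) ^ m * (3 / 4) := by
      rw [(hdet k).measureReal_inter (determinedBy_reversal m).compl disjoint_window, hcompl]
      gcongr
      exact ih k
    have h2 : coinLaw.real ({ω | reversals m ω + 1 ≤ k} ∩ reversal m) ≤
        2 ^ k * (7 / 8) ^ m * (1 / 8) := by
      rcases k with _ | k
      · simp; positivity
      · simp only [add_le_add_iff_right]
        rw [(hdet k).measureReal_inter (determinedBy_reversal m) disjoint_window,
          measure_reversal]
        have := ih k
        rw [pow_succ]
        linarith
    have hsub : {ω | reversals (m + 1) ω ≤ k} ⊆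
        ({ω | reversals m ω ≤ k} ∩ (reversal m)ᶜ) ∪
          ({ω | reversals m ω + 1 ≤ k} ∩ reversal m) := by
      intro ω hω
      simp only [Set.mem_ofPred_eq] at hω
      by_cases h : ω ∈ reversal m
      · exact Or.inr ⟨by rwa [reversals_succ_of_mem h] at hω, h⟩
      · exact Or.inl ⟨by rwa [reversals_succ_of_notMem h] at hω, h⟩
    calc _ ≤ _ := (measureReal_mono hsub).trans (measureReal_union_le _ _)
      _ ≤ _ := add_le_add h1 h2
      _ = _ := by rw [pow_succ (7 / 8 : ℝ)]; ring

/-! ### The excited walk driven by the coins -/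

/-- The site reached after `r` steps of the first and `s` steps of the second planar walk. -/
def position (r s : ℕ) (ω : Coins) : Fin 4 → ℤ :=
  ![(increment false 0 r ω).1, (increment false 0 r ω).2,
    (increment true 0 s ω).1, (increment true 0 s ω).2]

/-- The numbers of steps made from new and from old sites, and the set of sites left so far. -/
structure Clock where
  /-- The number of steps made from new sites. -/
  news : ℕ
  /-- The number of steps made from old sites. -/
  olds : ℕ
  /-- The set of sites left so far. -/
  visited : Finset (Fin 4 → ℤ)

/-- One step of the excited walk. -/
def advance (ω : Coins) (c : Clock) : Clock :=
  if position c.news c.olds ω ∈ c.visited then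
    ⟨c.news, c.olds + 1, insert (position c.news c.olds ω) c.visited⟩
  else ⟨c.news + 1, c.olds, insert (position c.news c.olds ω) c.visited⟩

/-- The clock of the excited walk at time `n`. -/
def clock (ω : Coins) : ℕ → Clock
  | 0 => ⟨0, 0, ∅⟩
  | n + 1 => advance ω (clock ω n)

/-- The excited walk driven by the coins `ω`. -/
def walk (n : ℕ) (ω : Coins) : Fin 4 → ℤ :=
  position (clock ω n).news (clock ω n).olds ω

variable {ω ω' : Coins} {n : ℕ}

lemma clock_succ_of_mem (h : walk n ω ∈ (clock ω n).visited) :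
    clock ω (n + 1) =
      ⟨(clock ω n).news, (clock ω n).olds + 1, insert (walk n ω) (clock ω n).visited⟩ := by
  exact if_pos h

lemma clock_succ_of_notMem (h : walk n ω ∉ (clock ω n).visited) :
    clock ω (n + 1) =
      ⟨(clock ω n).news + 1, (clock ω n).olds, insert (walk n ω) (clock ω n).visited⟩ := by
  exact if_neg h

lemma visited_succ (ω : Coins) (n : ℕ) :
    (clock ω (n + 1)).visited = insert (walk n ω) (clock ω n).visited := by
  by_cases h : walk n ω ∈ (clock ω n).visited
  · rw [clock_succ_of_mem h]
  · rw [clock_succ_of_notMem h]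

lemma mem_visited_iff {z : Fin 4 → ℤ} :
    z ∈ (clock ω n).visited ↔ ∃ k < n, walk k ω = z := by
  induction n with
  | zero => simp [clock]
  | succ n ih =>
    rw [visited_succ, Finset.mem_insert, ih]
    constructor
    · rintro (rfl | ⟨k, hk, rfl⟩)
      · exact ⟨n, Nat.lt_succ_self n, rfl⟩
      · exact ⟨k, hk.trans (Nat.lt_succ_self n), rfl⟩
    · rintro ⟨k, hk, rfl⟩
      rcases Nat.lt_succ_iff_lt_or_eq.1 hk with hk | rfl
      · exact Or.inr ⟨k, hk, rfl⟩
      · exact Or.inl rfl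

lemma news_add_olds (ω : Coins) (n : ℕ) : (clock ω n).news + (clock ω n).olds = n := by
  induction n with
  | zero => rfl
  | succ n ih =>
    by_cases h : walk n ω ∈ (clock ω n).visited
    · rw [clock_succ_of_mem h]; simp only; omega
    · rw [clock_succ_of_notMem h]; simp only; omega

lemma news_le_succ (ω : Coins) (n : ℕ) : (clock ω n).news ≤ (clock ω (n + 1)).news := by
  by_cases h : walk n ω ∈ (clock ω n).visited
  · rw [clock_succ_of_mem h]
  · rw [clock_succ_of_notMem h]; simp only; omega

lemma olds_le_succ (ω : Coins) (n : ℕ) : (clock ω n).olds ≤ (clock ω (n + 1)).olds := by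
  by_cases h : walk n ω ∈ (clock ω n).visited
  · rw [clock_succ_of_mem h]; simp only; omega
  · rw [clock_succ_of_notMem h]

lemma card_visited (ω : Coins) (n : ℕ) : (clock ω n).visited.card = (clock ω n).news := by
  induction n with
  | zero => rfl
  | succ n ih =>
    by_cases h : walk n ω ∈ (clock ω n).visited
    · rw [clock_succ_of_mem h]; simp only [Finset.insert_eq_of_mem h, ih]
    · rw [clock_succ_of_notMem h]; simp only [Finset.card_insert_of_notMem h, ih]

lemma trace_olds_subset (ω : Coins) (n : ℕ) :
    trace true (clock ω n).olds ω ⊆ (clock ω n).visited.image fun z => (z 2, z 3) := by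
  induction n with
  | zero => simp [clock, trace]
  | succ n ih =>
    by_cases h : walk n ω ∈ (clock ω n).visited
    · rw [clock_succ_of_mem h]
      simp only [trace, Finset.range_add_one, Finset.image_insert]
      refine Finset.insert_subset_insert _ ih |>.trans' ?_
      exact subset_rfl
    · rw [clock_succ_of_notMem h]
      exact ih.trans (Finset.image_subset_image (Finset.subset_insert _ _))

lemma card_trace_le_news (ω : Coins) (n : ℕ) :
    (trace true (clock ω n).olds ω).card ≤ (clock ω n).news :=
  (Finset.card_le_card (trace_olds_subset ω n)).trans
    (Finset.card_image_le.trans (card_visited ω n).le)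

lemma position_of_reversal {i : ℕ} (s : ℕ) (h : ω ∈ reversal i) :
    position (2 * (i + 1)) s ω = position (2 * i) s ω := by
  have h1 : increment false 0 (2 * (i + 1)) ω = increment false 0 (2 * i) ω := by
    rw [show 2 * (i + 1) = 2 * i + 1 + 1 by ring, increment_succ false (Nat.zero_le _),
      increment_succ false (Nat.zero_le _), add_assoc]
    have h2 : ω (false, 2 * i + 1) = opposite (ω (false, 2 * i)) := h
    rw [h2, step_add_step_opposite, add_zero]
  rw [position, h1, position]

lemma reversals_news_invariant (ω : Coins) (n : ℕ) :
    ∃ i, ((clock ω n).news = 2 * i ∧ (reversals i ω ≤ (clock ω n).olds ∨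
        (reversals i ω ≤ (clock ω n).olds + 1 ∧ walk n ω ∈ (clock ω n).visited))) ∨
      ((clock ω n).news = 2 * i + 1 ∧ reversals i ω ≤ (clock ω n).olds ∧
        (reversals i ω + 1 ≤ (clock ω n).olds ∨
          position (2 * i) (clock ω n).olds ω ∈ (clock ω n).visited)) := by
  induction n with
  | zero => exact ⟨0, Or.inl ⟨rfl, Or.inl (by simp [reversals])⟩⟩
  | succ n ih =>
    obtain ⟨i, ⟨hi, h⟩ | ⟨hi, h1, h2⟩⟩ := ih
    · refine ⟨i, ?_⟩
      by_cases hm : walk n ω ∈ (clock ω n).visited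
      · left
        rw [clock_succ_of_mem hm]
        exact ⟨hi, Or.inl (by simp only; rcases h with h | h <;> omega)⟩
      · right
        have h' : reversals i ω ≤ (clock ω n).olds := by
          rcases h with h | h
          · exact h
          · exact absurd h.2 hm
        rw [clock_succ_of_notMem hm]
        refine ⟨by simp only; omega, h', Or.inr ?_⟩
        simp only [walk, hi]
        exact Finset.mem_insert_self _ _
    · by_cases hm : walk n ω ∈ (clock ω n).visited
      · refine ⟨i, Or.inr ?_⟩
        rw [clock_succ_of_mem hm]
        exact ⟨hi, by simp only; omega, Or.inl (by simp only; omega)⟩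
      · refine ⟨i + 1, Or.inl ?_⟩
        have hw : walk (n + 1) ω = position (2 * (i + 1)) (clock ω n).olds ω := by
          rw [walk, clock_succ_of_notMem hm]
          simp only [hi]
          congr 1
        rw [hw, clock_succ_of_notMem hm]
        refine ⟨by simp only; omega, ?_⟩
        simp only
        by_cases hr : ω ∈ reversal i
        · rw [reversals_succ_of_mem hr, position_of_reversal _ hr]
          rcases h2 with h2 | h2
          · exact Or.inl h2
          · exact Or.inr ⟨by omega, Finset.mem_insert_of_mem h2⟩
        · rw [reversals_succ_of_notMem hr]
          exact Or.inl h1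

lemma reversals_le_olds (ω : Coins) (n : ℕ) :
    reversals ((clock ω n).news / 2) ω ≤ (clock ω n).olds + 1 := by
  obtain ⟨i, ⟨hi, h⟩ | ⟨hi, h1, h2⟩⟩ := reversals_news_invariant ω n
  · have : (clock ω n).news / 2 = i := by omega
    rw [this]
    omega
  · have : (clock ω n).news / 2 = i := by omega
    rw [this]
    omega

lemma position_congr {r s : ℕ}
    (h : ∀ i ∈ window false 0 r ∪ window true 0 s, ω i = ω' i) :
    position r s ω = position r s ω' := by
  rw [position, position, increment_congr fun i hi => h i (Finset.mem_union_left _ hi),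
    increment_congr fun i hi => h i (Finset.mem_union_right _ hi)]

lemma clock_congr
    (h : ∀ i ∈ window false 0 (clock ω n).news ∪ window true 0 (clock ω n).olds, ω i = ω' i) :
    clock ω n = clock ω' n := by
  induction n with
  | zero => rfl
  | succ n ih =>
    have h' : ∀ i ∈ window false 0 (clock ω n).news ∪ window true 0 (clock ω n).olds,
        ω i = ω' i := fun i hi => h i (Finset.union_subset_union
          (window_subset le_rfl (news_le_succ ω n)) (window_subset le_rfl (olds_le_succ ω n)) hi)
    have hc := ih h'
    rw [clock, clock, ← hc, advance, advance, position_congr h']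

lemma walk_congr
    (h : ∀ i ∈ window false 0 (clock ω n).news ∪ window true 0 (clock ω n).olds, ω i = ω' i) :
    walk n ω = walk n ω' := by
  rw [walk, walk, ← clock_congr h, position_congr h]

lemma news_mono (ω : Coins) : Monotone fun n => (clock ω n).news :=
  monotone_nat_of_le_succ (news_le_succ ω)

lemma olds_mono (ω : Coins) : Monotone fun n => (clock ω n).olds :=
  monotone_nat_of_le_succ (olds_le_succ ω)

lemma walk_congr_of_le {k : ℕ} (hk : k ≤ n)
    (h : ∀ i ∈ window false 0 (clock ω n).news ∪ window true 0 (clock ω n).olds, ω i = ω' i) :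
    walk k ω = walk k ω' :=
  walk_congr fun i hi => h i (Finset.union_subset_union
    (window_subset le_rfl (news_mono ω hk)) (window_subset le_rfl (olds_mono ω hk)) hi)

lemma clock_eq_of_walk_eq (h : ∀ k < n, walk k ω = walk k ω') : clock ω n = clock ω' n := by
  induction n with
  | zero => rfl
  | succ n ih =>
    have hc := ih fun k hk => h k (hk.trans (Nat.lt_succ_self n))
    have hw := h n (Nat.lt_succ_self n)
    by_cases hm : walk n ω ∈ (clock ω n).visited
    · rw [clock_succ_of_mem hm, clock_succ_of_mem (by rwa [← hw, ← hc]), hw, hc]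
    · rw [clock_succ_of_notMem hm, clock_succ_of_notMem (by rwa [← hw, ← hc]), hw, hc]

/-- The excited walk follows the trajectory `h` up to time `n`. -/
def follows (n : ℕ) (h : ℕ → Fin 4 → ℤ) : Set Coins := {ω | ∀ k ≤ n, walk k ω = h k}

lemma determinedBy_follows {h : ℕ → Fin 4 → ℤ} (hω : ω ∈ follows n h) :
    DeterminedBy (window false 0 (clock ω n).news ∪ window true 0 (clock ω n).olds)
      (follows n h) := by
  intro ω₁ ω₂ h12 h1 k hk
  have hc : clock ω₁ n = clock ω n :=
    clock_eq_of_walk_eq fun k hk => (h1 k hk.le).trans (hω k hk.le).symm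
  rw [← hc] at h12
  rw [← walk_congr_of_le hk h12]
  exact h1 k hk

lemma measurableSet_follows (n : ℕ) (h : ℕ → Fin 4 → ℤ) : MeasurableSet (follows n h) := by
  rcases (follows n h).eq_empty_or_nonempty with he | ⟨ω, hω⟩
  · rw [he]; exact MeasurableSet.empty
  · exact (determinedBy_follows hω).measurableSet

/-- The step of the excited walk from a new site (`b = false`) or from an old site (`b = true`)
when the coin shows `c`. -/
def jump (b : Bool) (c : Fin 4) : Fin 4 → ℤ :=
  match b with
  | false => ![(step c).1, (step c).2, 0, 0]
  | true => ![0, 0, (step c).1, (step c).2]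

lemma position_succ_left (r s : ℕ) (ω : Coins) :
    position (r + 1) s ω = position r s ω + jump false (ω (false, r)) := by
  rw [position, position, increment_succ false (Nat.zero_le r), jump]
  ext i
  fin_cases i <;> simp

lemma position_succ_right (r s : ℕ) (ω : Coins) :
    position r (s + 1) ω = position r s ω + jump true (ω (true, s)) := by
  rw [position, position, increment_succ true (Nat.zero_le s), jump]
  ext i
  fin_cases i <;> simp

lemma jump_injective (b : Bool) : Function.Injective (jump b) := by
  cases b <;> decide

lemma jump_false_eq (c : Fin 4) : ∃ i : Fin 4, i.1 < 2 ∧ ∃ ε : ℤ, (ε = 1 ∨ ε = -1) ∧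
    jump false c = ε • unitVec 4 i := by
  fin_cases c
  · exact ⟨0, by decide, 1, by decide, by decide⟩
  · exact ⟨0, by decide, -1, by decide, by decide⟩
  · exact ⟨1, by decide, 1, by decide, by decide⟩
  · exact ⟨1, by decide, -1, by decide, by decide⟩

lemma jump_true_eq (c : Fin 4) : ∃ i : Fin 4, 4 - 2 ≤ i.1 ∧ ∃ ε : ℤ, (ε = 1 ∨ ε = -1) ∧
    jump true c = ε • unitVec 4 i := by
  fin_cases c
  · exact ⟨2, by decide, 1, by decide, by decide⟩
  · exact ⟨2, by decide, -1, by decide, by decide⟩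
  · exact ⟨3, by decide, 1, by decide, by decide⟩
  · exact ⟨3, by decide, -1, by decide, by decide⟩

open Classical in
/-- Whether the site `h n` is old along the trajectory `h`. -/
noncomputable def isOld (n : ℕ) (h : ℕ → Fin 4 → ℤ) : Bool := decide (∃ k < n, h n = h k)

lemma le_measure_follows_succ (n : ℕ) (h : ℕ → Fin 4 → ℤ) (c : Fin 4)
    (hc : h (n + 1) = h n + jump (isOld n h) c) :
    coinLaw (follows n h) / 4 ≤ coinLaw (follows (n + 1) h) := by
  rcases (follows n h).eq_empty_or_nonempty with he | ⟨ω₀, hω₀⟩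
  · simp [he]
  have hclock : ∀ ω ∈ follows n h, clock ω n = clock ω₀ n := fun ω hω =>
    clock_eq_of_walk_eq fun k hk => (hω k hk.le).trans (hω₀ k hk.le).symm
  have hold : ∀ ω ∈ follows n h, (walk n ω ∈ (clock ω n).visited ↔ ∃ k < n, h n = h k) := by
    intro ω hω
    rw [mem_visited_iff]
    refine exists_congr fun k => and_congr_right fun hk => ?_
    rw [hω k hk.le, hω n le_rfl, eq_comm]
  obtain ⟨i, hi, hsub⟩ : ∃ i, i ∉ window false 0 (clock ω₀ n).news ∪
      window true 0 (clock ω₀ n).olds ∧ follows n h ∩ {ω | ω i = c} ⊆ follows (n + 1) h := by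
    by_cases hb : ∃ k < n, h n = h k
    · refine ⟨(true, (clock ω₀ n).olds), by simp [mem_window], ?_⟩
      rintro ω ⟨h1, h2⟩ k hk
      rcases Nat.le_succ_iff.1 hk with hk | rfl
      · exact h1 k hk
      · rw [← hclock ω h1] at h2
        simp only [Set.mem_ofPred_eq] at h2
        rw [hc, walk, clock_succ_of_mem ((hold ω h1).2 hb), position_succ_right, h2, ← h1 n le_rfl]
        simp [isOld, hb, walk]
    · refine ⟨(false, (clock ω₀ n).news), by simp [mem_window], ?_⟩
      rintro ω ⟨h1, h2⟩ k hk
      rcases Nat.le_succ_iff.1 hk with hk | rfl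
      · exact h1 k hk
      · rw [← hclock ω h1] at h2
        simp only [Set.mem_ofPred_eq] at h2
        rw [hc, walk, clock_succ_of_notMem (fun h' => hb ((hold ω h1).1 h')),
          position_succ_left, h2, ← h1 n le_rfl]
        simp only [isOld, hb, walk, decide_false]
  calc coinLaw (follows n h) / 4 = coinLaw (follows n h ∩ {ω | ω i = c}) := by
        rw [(determinedBy_follows hω₀).measure_inter (determinedBy_eval i c)
          (Finset.disjoint_singleton_right.2 hi), coinLaw_eval, div_eq_mul_inv]
    _ ≤ _ := measure_mono hsub

section Coupling

variable {Ω : Type*} [MeasurableSpace Ω] {P : Measure Ω} {S : ℕ → Ω → Fin 4 → ℤ}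

lemma measure_next_eq (hS : IsBERW 4 2 2 P S) (n : ℕ) (h : ℕ → Fin 4 → ℤ) (c : Fin 4) :
    P {ω | (∀ k ≤ n, S k ω = h k) ∧ S (n + 1) ω = h n + jump (isOld n h) c} =
      P {ω | ∀ k ≤ n, S k ω = h k} / 4 := by
  have e : (2 * ((2 : ℕ) : ENNReal)) = 4 := by norm_num
  obtain ⟨-, -, hnew, hold⟩ := hS
  by_cases hb : ∃ k < n, h n = h k
  · obtain ⟨i, hi, ε, hε, he⟩ := jump_true_eq c
    have := hold n h hb i hi ε hε
    rw [e] at this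
    simp only [isOld, hb, decide_true, he, this]
  · obtain ⟨i, hi, ε, hε, he⟩ := jump_false_eq c
    have := hnew n h (fun k hk hh => hb ⟨k, hk, hh⟩) i hi ε hε
    rw [e] at this
    simp only [isOld, hb, decide_false, he, this]

lemma measurableSet_path (hS : IsBERW 4 2 2 P S) (n : ℕ) (h : ℕ → Fin 4 → ℤ) :
    MeasurableSet {ω | ∀ k ≤ n, S k ω = h k} := by
  have : {ω | ∀ k ≤ n, S k ω = h k} = ⋂ k, ⋂ (_ : k ≤ n), S k ⁻¹' {h k} := by
    ext ω; simp
  rw [this]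
  exact MeasurableSet.iInter fun k => MeasurableSet.iInter fun _ =>
    hS.1 k (measurableSet_singleton _)

lemma measure_next_eq_zero [IsFiniteMeasure P] (hS : IsBERW 4 2 2 P S) (n : ℕ)
    (h : ℕ → Fin 4 → ℤ) (z : Fin 4 → ℤ) (hz : ∀ c, z ≠ h n + jump (isOld n h) c) :
    P {ω | (∀ k ≤ n, S k ω = h k) ∧ S (n + 1) ω = z} = 0 := by
  set A : Set Ω := {ω | ∀ k ≤ n, S k ω = h k} with hA
  have hAm : MeasurableSet A := measurableSet_path hS n h
  have hstep : ∀ w, MeasurableSet {ω | S (n + 1) ω = w} := fun w =>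
    hS.1 (n + 1) (measurableSet_singleton w)
  set U : Set Ω := ⋃ c ∈ (Finset.univ : Finset (Fin 4)),
    {ω | (∀ k ≤ n, S k ω = h k) ∧ S (n + 1) ω = h n + jump (isOld n h) c} with hU
  have hUm : MeasurableSet U :=
    Finset.measurableSet_biUnion _ fun c _ => hAm.inter (hstep _)
  have hPU : P U = P A := by
    rw [hU, measure_biUnion_finset]
    · simp_rw [measure_next_eq hS n h]
      rw [Finset.sum_const, Finset.card_univ, Fintype.card_fin, nsmul_eq_mul]
      push_cast
      exact ENNReal.mul_div_cancel (by norm_num) (by norm_num)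
    · intro c _ c' _ hcc
      refine Set.disjoint_left.2 ?_
      rintro ω ⟨_, h1⟩ ⟨_, h2⟩
      exact hcc (jump_injective _ (add_left_cancel (h1.symm.trans h2)))
    · intro c _
      exact hAm.inter (hstep _)
  have hUA : U ⊆ A := by
    intro ω hω
    simp only [hU, Set.mem_iUnion] at hω
    obtain ⟨c, _, h1, _⟩ := hω
    exact h1
  have hdiff : P (A \ U) = 0 := by
    rw [measure_sdiff hUA hUm.nullMeasurableSet (measure_ne_top _ _), hPU, tsub_self]
  refine measure_mono_null ?_ hdiff
  rintro ω ⟨h1, h2⟩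
  refine ⟨h1, fun h3 => ?_⟩
  simp only [hU, Set.mem_iUnion] at h3
  obtain ⟨c, _, _, h4⟩ := h3
  exact hz c (h2.symm.trans h4)

lemma measure_path_le [IsProbabilityMeasure P] (hS : IsBERW 4 2 2 P S) (n : ℕ)
    (h : ℕ → Fin 4 → ℤ) : P {ω | ∀ k ≤ n, S k ω = h k} ≤ coinLaw (follows n h) := by
  induction n with
  | zero =>
    have hw : ∀ ω, walk 0 ω = 0 := fun ω => by
      ext i
      fin_cases i <;> simp [walk, clock, position]
    by_cases h0 : h 0 = 0
    · have : follows 0 h = Set.univ := by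
        ext ω; simp [follows, hw, h0]
      rw [this, measure_univ]
      exact prob_le_one
    · have : P {ω | ∀ k ≤ 0, S k ω = h k} = 0 := by
        refine measure_mono_null ?_ (ae_iff.1 hS.2.1)
        intro ω hω h1
        exact h0 ((hω 0 le_rfl).symm.trans h1)
      rw [this]
      exact zero_le
  | succ n ih =>
    have e : {ω | ∀ k ≤ n + 1, S k ω = h k} =
        {ω | (∀ k ≤ n, S k ω = h k) ∧ S (n + 1) ω = h (n + 1)} := by
      ext ω
      constructor
      · exact fun hω => ⟨fun k hk => hω k (hk.trans n.le_succ), hω _ le_rfl⟩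
      · rintro ⟨h1, h2⟩ k hk
        rcases Nat.le_succ_iff.1 hk with hk | rfl
        · exact h1 k hk
        · exact h2
    rw [e]
    by_cases hc : ∃ c, h (n + 1) = h n + jump (isOld n h) c
    · obtain ⟨c, hc⟩ := hc
      have := measure_next_eq hS n h c
      rw [← hc] at this
      rw [this]
      exact (ENNReal.div_le_div_right ih 4).trans (le_measure_follows_succ n h c hc)
    · rw [measure_next_eq_zero hS n h _ fun c hh => hc ⟨c, hh⟩]
      exact zero_le

/-- Extension by `0` of a finite trajectory. -/
def extend (c : ℕ) (p : Fin (c + 1) → Fin 4 → ℤ) (k : ℕ) : Fin 4 → ℤ :=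
  if hk : k < c + 1 then p ⟨k, hk⟩ else 0

lemma visit_eq_preimage {α : Type*} (X : ℕ → α → Fin 4 → ℤ) (a c : ℕ) (v : Fin 4 → ℤ) :
    {ω | ∃ n, a ≤ n ∧ n < c ∧ X n ω = v} = (fun ω (i : Fin (c + 1)) => X i ω) ⁻¹'
      {p | ∃ n : Fin (c + 1), a ≤ n ∧ n.1 < c ∧ p n = v} := by
  ext ω
  constructor
  · rintro ⟨n, h1, h2, h3⟩
    exact ⟨⟨n, h2.trans c.lt_succ_self⟩, h1, h2, h3⟩
  · rintro ⟨n, h1, h2, h3⟩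
    exact ⟨n, h1, h2, h3⟩

lemma preimage_singleton_eq_path {α : Type*} (X : ℕ → α → Fin 4 → ℤ) (c : ℕ)
    (p : Fin (c + 1) → Fin 4 → ℤ) :
    (fun ω (i : Fin (c + 1)) => X i ω) ⁻¹' {p} = {ω | ∀ k ≤ c, X k ω = extend c p k} := by
  ext ω
  constructor
  · intro h k hk
    have h' : (fun i : Fin (c + 1) => X i ω) = p := h
    simp only [extend, Nat.lt_succ_of_le hk, dif_pos, ← h']
  · intro h
    refine funext fun k => ?_
    have := h k (Nat.le_of_lt_succ k.2)
    simpa only [extend, k.2, dif_pos] using this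

lemma measure_visit_le [IsProbabilityMeasure P] (hS : IsBERW 4 2 2 P S) (a c : ℕ)
    (v : Fin 4 → ℤ) :
    P {ω | ∃ n, a ≤ n ∧ n < c ∧ S n ω = v} ≤
      coinLaw {ω | ∃ n, a ≤ n ∧ n < c ∧ walk n ω = v} := by
  rw [visit_eq_preimage S, visit_eq_preimage walk,
    ← tsum_measure_preimage_singleton (Set.to_countable _),
    ← tsum_measure_preimage_singleton (Set.to_countable _)]
  · refine ENNReal.tsum_le_tsum fun p => ?_
    rw [preimage_singleton_eq_path S, preimage_singleton_eq_path walk]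
    exact measure_path_le hS c _
  · intro p _
    rw [preimage_singleton_eq_path walk]
    exact measurableSet_follows c _
  · intro p _
    rw [preimage_singleton_eq_path S]
    exact measurableSet_path hS c _

end Coupling

/-! ### Visits during a block of times -/

/-- The walk visits `v` at a time in `[2 ^ (i + 4) ^ 2, 2 ^ (i + 5) ^ 2)`. -/
def blockVisit {α : Type*} (X : ℕ → α → Fin 4 → ℤ) (v : Fin 4 → ℤ) (i : ℕ) : Set α :=
  {ω | ∃ n, 2 ^ (i + 4) ^ 2 ≤ n ∧ n < 2 ^ (i + 5) ^ 2 ∧ X n ω = v}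

/-- The walk driven by the `true` coins has a small trace at scale `i`. -/
def smallTrace (i : ℕ) : Set Coins :=
  {ω | (trace true (2 ^ (i ^ 2 + 8 * i + 15)) ω).card * 2 ^ (i + 4) ≤ 2 ^ (i ^ 2 + 8 * i + 15)}

/-- The walk driven by the `false` coins has few reversals at scale `i`. -/
def fewReversals (i : ℕ) : Set Coins :=
  {ω | reversals (8 * 2 ^ (i ^ 2 + 8 * i + 11)) ω ≤ 2 ^ (i ^ 2 + 8 * i + 11)}

lemma trace_mono (b : Bool) {m m' : ℕ} (h : m ≤ m') (ω : Coins) : trace b m ω ⊆ trace b m' ω :=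
  Finset.image_subset_image (Finset.range_mono h)

lemma blockVisit_walk_subset (v : Fin 4 → ℤ) (i : ℕ) :
    blockVisit walk v i ⊆ smallTrace i ∪ fewReversals i ∪
      (hits false (2 ^ (i ^ 2 + 7 * i + 11)) (2 ^ (i ^ 2 + 10 * i + 24 + 1)) (v 0, v 1) ∩
        hits true (2 ^ (i ^ 2 + 7 * i + 11)) (2 ^ (i ^ 2 + 10 * i + 24 + 1)) (v 2, v 3)) := by
  rintro ω ⟨n, hn, hn', hv⟩
  by_contra hω
  simp only [Set.mem_union, not_or] at hω
  obtain ⟨⟨hT, hR⟩, hH⟩ := hω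
  refine hH ?_
  simp only [smallTrace, fewReversals, Set.mem_ofPred_eq, not_le] at hT hR
  rw [show i ^ 2 + 8 * i + 15 = (i ^ 2 + 7 * i + 11) + (i + 4) by ring, pow_add] at hT
  have hT' := lt_of_mul_lt_mul_right hT (Nat.zero_le _)
  rw [← pow_add, show (i ^ 2 + 7 * i + 11) + (i + 4) = i ^ 2 + 8 * i + 15 by ring] at hT'
  rw [show (i + 4) ^ 2 = i ^ 2 + 8 * i + 15 + 1 by ring, pow_succ] at hn
  rw [show (i + 5) ^ 2 = i ^ 2 + 10 * i + 24 + 1 by ring] at hn'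
  have hsum := news_add_olds ω n
  have hnews := card_trace_le_news ω n
  have holds := reversals_le_olds ω n
  have hle : 2 ^ (i ^ 2 + 7 * i + 11) ≤ 2 ^ (i ^ 2 + 8 * i + 11) :=
    Nat.pow_le_pow_right two_pos (by linarith)
  have h16 : 2 ^ (i ^ 2 + 8 * i + 15) = 16 * 2 ^ (i ^ 2 + 8 * i + 11) := by ring
  have key : 2 ^ (i ^ 2 + 7 * i + 11) ≤ (clock ω n).news ∧
      2 ^ (i ^ 2 + 7 * i + 11) ≤ (clock ω n).olds := by
    rcases le_total (2 ^ (i ^ 2 + 8 * i + 15)) (clock ω n).olds with hs | hs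
    · have := Finset.card_le_card (trace_mono true hs ω)
      omega
    · have hr : 8 * 2 ^ (i ^ 2 + 8 * i + 11) ≤ (clock ω n).news / 2 := by omega
      have := reversals_mono hr ω
      omega
  refine ⟨⟨(clock ω n).news, key.1, by omega, ?_⟩, ⟨(clock ω n).olds, key.2, by omega, ?_⟩⟩
  · rw [← hv]; rfl
  · rw [← hv]; rfl

lemma measure_smallTrace_le (i : ℕ) :
    coinLaw.real (smallTrace i) ≤ 2 * ((i + 4 : ℕ) ^ 2 * (1 / 2) ^ (i + 4)) := by
  refine (measure_card_trace_le true _ (2 ^ (i + 4)) (by positivity)).trans (le_of_eq ?_)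
  push_cast
  rw [one_div, inv_pow]
  ring

lemma measure_fewReversals_le (i : ℕ) : coinLaw.real (fewReversals i) ≤ (3 / 4) ^ i := by
  refine (measure_reversals_le _ _).trans ?_
  rw [pow_mul, ← mul_pow]
  calc _ ≤ (3 / 4 : ℝ) ^ 2 ^ (i ^ 2 + 8 * i + 11) := by gcongr; norm_num
    _ ≤ _ := by
        refine pow_le_pow_of_le_one (by norm_num) (by norm_num) ?_
        calc i ≤ i ^ 2 + 8 * i + 11 := by nlinarith
          _ ≤ _ := Nat.lt_two_pow_self.le

lemma measure_hits_block_le (b : Bool) (i : ℕ) (v : ℤ × ℤ) :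
    coinLaw.real (hits b (2 ^ (i ^ 2 + 7 * i + 11)) (2 ^ (i ^ 2 + 10 * i + 24 + 1)) v) ≤
      24 / (i + 4 : ℕ) := by
  have h := measure_hits_two_pow_mul_le b
    (show i ^ 2 + 7 * i + 11 ≤ i ^ 2 + 10 * i + 24 + 1 by linarith) v
  rw [le_div_iff₀ (by positivity)]
  push_cast at h ⊢
  have h' : coinLaw.real
      (hits b (2 ^ (i ^ 2 + 7 * i + 11)) (2 ^ (i ^ 2 + 10 * i + 24 + 1)) v) * (i + 4) * (i + 6) ≤
      24 * (i + 6) := by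
    linarith
  exact le_of_mul_le_mul_right h' (by positivity)

lemma measure_blockVisit_walk_le (v : Fin 4 → ℤ) (i : ℕ) :
    coinLaw.real (blockVisit walk v i) ≤
      2 * ((i + 4 : ℕ) ^ 2 * (1 / 2) ^ (i + 4)) + (3 / 4) ^ i + 576 * (1 / (i + 4 : ℕ) ^ 2) := by
  refine (measureReal_mono (blockVisit_walk_subset v i)).trans ?_
  refine (measureReal_union_le _ _).trans (add_le_add ((measureReal_union_le _ _).trans
    (add_le_add (measure_smallTrace_le i) (measure_fewReversals_le i))) ?_)
  rw [(determinedBy_hits _ _ _ _).measureReal_inter (determinedBy_hits _ _ _ _)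
    (disjoint_window_not (by decide))]
  calc _ ≤ 24 / ((i + 4 : ℕ) : ℝ) * (24 / ((i + 4 : ℕ) : ℝ)) :=
        mul_le_mul (measure_hits_block_le _ _ _) (measure_hits_block_le _ _ _)
          measureReal_nonneg (by positivity)
    _ = _ := by ring

lemma summable_block_bound :
    Summable fun i : ℕ =>
      2 * (((i + 4 : ℕ) : ℝ) ^ 2 * (1 / 2) ^ (i + 4)) + (3 / 4) ^ i +
        576 * (1 / ((i + 4 : ℕ) : ℝ) ^ 2) := by
  have h1 : Summable fun i : ℕ => (i : ℝ) ^ 2 * (1 / 2) ^ i :=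
    summable_pow_mul_geometric_of_norm_lt_one 2 (by norm_num)
  have h2 : Summable fun i : ℕ => 1 / (i : ℝ) ^ 2 := Real.summable_one_div_nat_pow.2 one_lt_two
  have h3 : Summable fun i : ℕ => (3 / 4 : ℝ) ^ i :=
    summable_geometric_of_lt_one (by norm_num) (by norm_num)
  exact ((((summable_nat_add_iff 4).2 h1).mul_left 2).add h3).add
    (((summable_nat_add_iff 4).2 h2).mul_left 576)

/-- A site that is visited in finitely many blocks is visited finitely often. -/
lemma finite_of_eventually_notMem_blockVisit {α : Type*} {X : ℕ → α → Fin 4 → ℤ}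
    {v : Fin 4 → ℤ} {ω : α} (h : ∀ᶠ i in atTop, ω ∉ blockVisit X v i) :
    {n | X n ω = v}.Finite := by
  obtain ⟨I, hI⟩ := eventually_atTop.1 h
  refine (Set.finite_Iio (2 ^ (I + 4) ^ 2)).subset fun n hn => ?_
  by_contra hlt
  simp only [Set.mem_Iio, not_lt] at hlt
  have hex : ∃ j, n < 2 ^ (j + 4) ^ 2 :=
    ⟨n, n.lt_two_pow_self.trans_le (Nat.pow_le_pow_right two_pos (by nlinarith))⟩
  classical
  have hlow : ∀ j < Nat.find hex, 2 ^ (j + 4) ^ 2 ≤ n := fun j hj => not_lt.1 (Nat.find_min hex hj)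
  have hhigh := Nat.find_spec hex
  have hIj : I < Nat.find hex := by
    by_contra hle
    have : 2 ^ (Nat.find hex + 4) ^ 2 ≤ 2 ^ (I + 4) ^ 2 := by gcongr <;> omega
    omega
  obtain ⟨j, hj⟩ : ∃ j, Nat.find hex = j + 1 := ⟨Nat.find hex - 1, by omega⟩
  rw [hj] at hlow hhigh hIj
  exact hI j (by omega) ⟨n, hlow j (by omega), hhigh, hn⟩

end BERW

/-- The `M₄(2,2)` balanced excited random walk on `ℤ⁴` is transient. -/
theorem berw_M4_2_2_transient {Ω : Type*} [MeasurableSpace Ω]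
    (P : Measure Ω) [IsProbabilityMeasure P]
    (S : ℕ → Ω → Fin 4 → ℤ) (hS : IsBERW 4 2 2 P S) :
    IsTransientWalk 4 P S := by
  refine ae_all_iff.2 fun v => ?_
  have hsum : ∑' i, P (BERW.blockVisit S v i) ≠ ⊤ := by
    refine ne_top_of_le_ne_top BERW.summable_block_bound.tsum_ofReal_ne_top
      (ENNReal.tsum_le_tsum fun i => (BERW.measure_visit_le hS _ _ v).trans ?_)
    rw [← ofReal_measureReal]
    exact ENNReal.ofReal_le_ofReal (BERW.measure_blockVisit_walk_le v i)
  filter_upwards [ae_eventually_notMem hsum] with ω hω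
  exact BERW.finite_of_eventually_notMem_blockVisit hω
end
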